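/- arXiv:2107.08651 — 2 statements merged into one kernel-verified Lean document; each statement's English description precedes it below -/
import Mathlib

section
/- Let z, v : [0,L]×[0,∞)→ℝ and β : [0,L]×[0,D]×[0,∞)→ℝ be continuously differentiable functions satisfying the target system: ∂_t z(x,t) = −c1·∂_x z(x,t) + c1·c2·z(x,t) − c3·exp(c2·x)·β(x,0,t) − (k·c3/c6)·exp(c2·x)·v(x,t) and ∂_t v(x,t) = c4·∂_x v(x,t) − c6·β(x,0,t) − k·v(x,t) for x∈(0,L) and t>0; z(0,t) = −c7·v(0,t); ∂_t v(L,t) = −k·v(L,t) − c6·β(L,0,t); ∂_t β(x,s,t) = ∂_s β(x,s,t) for (x,s)∈(0,L)×(0,D); and β(x,D,t) = 0 for all x∈[0,L], t≥0. Then the equilibrium at zero is exponentially stable in the L² sense: there exist constants N, θ > 0, depending only on L, D, c1, …, c7, k, such that for all t > 0, ‖z(·,t)‖² + ‖v(·,t)‖² + |v(L,t)|² + ‖β(·,·,t)‖² + ‖β(L,·,t)‖² ≤ N·exp(−θ·t)·(‖z(·,0)‖² + ‖v(·,0)‖² + |v(L,0)|² + ‖β(·,·,0)‖² + ‖β(L,·,0)‖²).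 -/
open Set MeasureTheory

noncomputable section

/-- Squared `L²`-norm of a function on `[0, L]`. -/
def nX (L : ℝ) (f : ℝ → ℝ) : ℝ := ∫ x in (0:ℝ)..L, f x ^ 2

/-- Squared `L²`-norm of a function on `[0, D]`. -/
def nS (D : ℝ) (f : ℝ → ℝ) : ℝ := ∫ s in (0:ℝ)..D, f s ^ 2

/-- Squared `L²`-norm of a function on `[0, L] × [0, D]`. -/
def n2 (L D : ℝ) (f : ℝ → ℝ → ℝ) : ℝ := ∫ x in (0:ℝ)..L, ∫ s in (0:ℝ)..D, f x s ^ 2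

/-- The fixed constants of the problem. -/
structure Params where
  L : ℝ
  D : ℝ
  c1 : ℝ
  c2 : ℝ
  c3 : ℝ
  c4 : ℝ
  c5 : ℝ
  c6 : ℝ
  c7 : ℝ
  k : ℝ

namespace Params

/-- All constants are strictly positive and `(c1 + c4) * D < L`. -/
def Pos (P : Params) : Prop :=
  0 < P.L ∧ 0 < P.D ∧ 0 < P.c1 ∧ 0 < P.c2 ∧ 0 < P.c3 ∧ 0 < P.c4 ∧ 0 < P.c5 ∧
    0 < P.c6 ∧ 0 < P.c7 ∧ 0 < P.k ∧ (P.c1 + P.c4) * P.D < P.L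

/-- The kernel `g(x,y,τ)`. -/
def gk (P : Params) (x y τ : ℝ) : ℝ :=
  P.k * P.c1 * P.c2 / (P.c1 + P.c4) *
    Real.exp (-(P.c1 * P.c2 / (P.c1 + P.c4)) * (x - y + P.c4 * τ))

/-- The kernel `𝔨(x,s,y)`. -/
def kk (P : Params) (x s y : ℝ) : ℝ :=
  P.k * P.c5 / (P.c6 * (P.c1 + P.c4)) *
    Real.exp (-(P.c1 * P.c2 / (P.c1 + P.c4)) * x -
      P.c2 * P.c4 / (P.c1 + P.c4) * (y + P.c1 * s))

/-- The function `𝔠(x,τ)`. -/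
def cc (P : Params) (x τ : ℝ) : ℝ :=
  (P.c1 + P.c4) / P.c4 * P.L - P.c1 / P.c4 * x - P.c1 * τ

def T1 (P : Params) (ψ : ℝ → ℝ → ℝ) (x s : ℝ) : ℝ :=
  ψ x s
    - (∫ τ in (0:ℝ)..(x / P.c1),
        P.c1 * P.c2 * Real.exp (-(P.c1 * P.c2 * τ)) * ψ (x - P.c1 * τ) (s - τ))
    + (∫ τ in (x / P.c1)..s,
        P.c5 * P.c7 * Real.exp (-(P.c2 * x)) * ψ (P.c4 * (τ - x / P.c1)) (s - τ))
    + (∫ τ in (0:ℝ)..s, P.k * ψ (x + P.c4 * τ) (s - τ))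
    - (∫ τ in (0:ℝ)..s,
        ∫ y in (max (x - P.c1 * τ) (P.c4 * (τ - x / P.c1)))..(x + P.c4 * τ),
          P.gk x y τ * ψ y (s - τ))

def T2 (P : Params) (ψ : ℝ → ℝ → ℝ) (x s : ℝ) : ℝ :=
  ψ x s
    - (∫ τ in (0:ℝ)..s,
        P.c1 * P.c2 * Real.exp (-(P.c1 * P.c2 * τ)) * ψ (x - P.c1 * τ) (s - τ))
    + (∫ τ in (0:ℝ)..s, P.k * ψ (x + P.c4 * τ) (s - τ))
    - (∫ τ in (0:ℝ)..s,
        ∫ y in (x - P.c1 * τ)..(x + P.c4 * τ), P.gk x y τ * ψ y (s - τ))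

def T3 (P : Params) (ψ : ℝ → ℝ → ℝ) (x s : ℝ) : ℝ :=
  ψ x s
    - (∫ τ in (0:ℝ)..s,
        P.c1 * P.c2 * Real.exp (-(P.c1 * P.c2 * τ)) * ψ (x - P.c1 * τ) (s - τ))
    + (∫ τ in (0:ℝ)..((P.L - x) / P.c4), P.k * ψ (x + P.c4 * τ) (s - τ))
    + (∫ τ in ((P.L - x) / P.c4)..s, P.k * ψ P.L (s - τ))
    - (∫ τ in (0:ℝ)..s,
        ∫ y in (x - P.c1 * τ)..(min (x + P.c4 * τ) (P.cc x τ)),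
          P.gk x y τ * ψ y (s - τ))
    - (∫ τ in ((P.L - x) / P.c4)..s,
        ∫ y in (P.cc x τ)..P.L, P.k * P.c2 * Real.exp (-(P.c2 * P.L)) * ψ y (s - τ))

def Z1 (P : Params) (z : ℝ → ℝ) (x s : ℝ) : ℝ :=
  (∫ y in (0:ℝ)..(P.c4 * (s - x / P.c1)),
      P.c5 * (P.k + P.c5 * P.c7) / (P.c6 * (P.c1 + P.c4)) *
        Real.exp (-(P.c2 * (x + y))) * z y)
    + (∫ y in (P.c4 * (s - x / P.c1))..(x + P.c4 * s), P.kk x s y * z y)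

def Z2 (P : Params) (z : ℝ → ℝ) (x s : ℝ) : ℝ :=
  P.c5 / P.c6 * Real.exp (-(P.c2 * x)) * z (x - P.c1 * s)
    + (∫ y in (x - P.c1 * s)..(x + P.c4 * s), P.kk x s y * z y)

def Z3 (P : Params) (z : ℝ → ℝ) (x s : ℝ) : ℝ :=
  P.c5 / P.c6 * Real.exp (-(P.c2 * x)) * z (x - P.c1 * s)
    + (∫ y in (P.cc x s)..P.L,
        P.k * P.c5 / (P.c1 * P.c6) * Real.exp (-(P.c2 * P.L)) * z y)
    + (∫ y in (x - P.c1 * s)..(P.cc x s), P.kk x s y * z y)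

def Y1 (P : Params) (v : ℝ → ℝ) (x s : ℝ) : ℝ :=
  -(P.c5 * P.c7 / P.c6) * Real.exp (-(P.c2 * x)) * v (P.c4 * (s - x / P.c1))
    - P.k / P.c6 * v (x + P.c4 * s)
    - (∫ y in (0:ℝ)..(P.c4 * (s - x / P.c1)),
        P.c1 * P.c5 * P.c7 * (P.k + P.c5 * P.c7) / (P.c4 * P.c6 * (P.c1 + P.c4)) *
          Real.exp (-(P.c2 * x)) * v y)

def Y2 (P : Params) (v : ℝ → ℝ) (x s : ℝ) : ℝ :=
  -(P.k / P.c6) * v (x + P.c4 * s)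

/-- The backstepping transform of `(ψ, z, v)`. -/
def beta (P : Params) (ψ : ℝ → ℝ → ℝ) (z v : ℝ → ℝ) (x s : ℝ) : ℝ :=
  if x ≤ P.c1 * s then P.T1 ψ x s + P.Z1 z x s + P.Y1 v x s
  else if x ≤ P.L - P.c4 * s then P.T2 ψ x s + P.Z2 z x s + P.Y2 v x s
  else P.T3 ψ x s + P.Z3 z x s - P.k / P.c6 * v P.L

/-- The kernel `𝔮(x,y,τ)` of the inverse transformation. -/
def qk (P : Params) (x y τ : ℝ) : ℝ :=
  P.k * P.c1 * P.c2 / (P.c1 + P.c4) *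
    Real.exp (P.k * (x - y - P.c1 * τ) / (P.c1 + P.c4))

def Q1 (P : Params) (β : ℝ → ℝ → ℝ) (x s : ℝ) : ℝ :=
  β x s
    - (∫ τ in (x / P.c1)..s,
        ∫ y in (P.c4 * (τ - x / P.c1))..(x + P.c4 * τ), P.qk x y τ * β y (s - τ))
    - (∫ τ in (0:ℝ)..(x / P.c1),
        ∫ y in (x - P.c1 * τ)..(x + P.c4 * τ), P.qk x y τ * β y (s - τ))
    - (∫ τ in (x / P.c1)..s,
        P.c2 * P.c4 * Real.exp (P.k * (x / P.c1 - τ)) *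
          β (P.c4 * (τ - x / P.c1)) (s - τ))
    + (∫ τ in (0:ℝ)..(x / P.c1), P.c1 * P.c2 * β (x - P.c1 * τ) (s - τ))
    - (∫ τ in (0:ℝ)..s, P.k * Real.exp (-(P.k * τ)) * β (x + P.c4 * τ) (s - τ))

def Q2 (P : Params) (β : ℝ → ℝ → ℝ) (x s : ℝ) : ℝ :=
  β x s
    - (∫ τ in (0:ℝ)..s,
        ∫ y in (x - P.c1 * τ)..(x + P.c4 * τ), P.qk x y τ * β y (s - τ))
    + (∫ τ in (0:ℝ)..s, P.c1 * P.c2 * β (x - P.c1 * τ) (s - τ))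
    - (∫ τ in (0:ℝ)..s, P.k * Real.exp (-(P.k * τ)) * β (x + P.c4 * τ) (s - τ))

def Q3 (P : Params) (β : ℝ → ℝ → ℝ) (x s : ℝ) : ℝ :=
  β x s
    - (∫ τ in (0:ℝ)..s,
        ∫ y in (x - P.c1 * τ)..(min P.L (x + P.c4 * τ)), P.qk x y τ * β y (s - τ))
    + (∫ τ in (0:ℝ)..s, P.c1 * P.c2 * β (x - P.c1 * τ) (s - τ))
    - (∫ τ in ((P.L - x) / P.c4)..s,
        (P.c1 * P.c2 * Real.exp (P.k * (x - P.L - P.c1 * τ) / (P.c1 + P.c4))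
            - P.c1 * P.c2 * Real.exp (-(P.k * τ)) + P.k * Real.exp (-(P.k * τ))) *
          β P.L (s - τ))
    - (∫ τ in (0:ℝ)..((P.L - x) / P.c4),
        P.k * Real.exp (-(P.k * τ)) * β (x + P.c4 * τ) (s - τ))

def R1 (P : Params) (v : ℝ → ℝ) (x s : ℝ) : ℝ :=
  P.c2 * P.c4 / P.c6 * Real.exp (P.k * (x / P.c1 - s)) * v (P.c4 * (s - x / P.c1))
    + P.k / P.c6 * Real.exp (-(P.k * s)) * v (x + P.c4 * s)
    + (∫ y in (P.c4 * (s - x / P.c1))..(x + P.c4 * s),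
        P.k * P.c1 * P.c2 / (P.c6 * (P.c1 + P.c4)) *
          Real.exp (P.k * (x - y - P.c1 * s) / (P.c1 + P.c4)) * v y)

def R2 (P : Params) (v : ℝ → ℝ) (x s : ℝ) : ℝ :=
  P.k / P.c6 * Real.exp (-(P.k * s)) * v (x + P.c4 * s)
    + (∫ y in (x - P.c1 * s)..(x + P.c4 * s),
        P.k * P.c1 * P.c2 / (P.c6 * (P.c1 + P.c4)) *
          Real.exp (P.k * (x - y - P.c1 * s) / (P.c1 + P.c4)) * v y)

def R3 (P : Params) (v : ℝ → ℝ) (x s : ℝ) : ℝ :=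
  (∫ y in (x - P.c1 * s)..P.L,
      P.k * P.c1 * P.c2 / (P.c6 * (P.c1 + P.c4)) *
        Real.exp (P.k * (x - y - P.c1 * s) / (P.c1 + P.c4)) * v y)
    + (P.c1 * P.c2 / P.c6 *
          (Real.exp (P.k * (x - P.L - P.c1 * s) / (P.c1 + P.c4)) -
            Real.exp (-(P.k * s)))
        + P.k / P.c6 * Real.exp (-(P.k * s))) * v P.L

def Binv (P : Params) (z : ℝ → ℝ) (x s : ℝ) : ℝ :=
  -(P.c5 / P.c6) * Real.exp (P.c2 * (P.c1 * s - x)) * z (x - P.c1 * s)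

/-- The inverse backstepping transform of `(β, z, v)`. -/
def psiInv (P : Params) (β : ℝ → ℝ → ℝ) (z v : ℝ → ℝ) (x s : ℝ) : ℝ :=
  if x < P.c1 * s then P.Q1 β x s + P.R1 v x s
  else if x ≤ P.L - P.c4 * s then P.Q2 β x s + P.R2 v x s + P.Binv z x s
  else P.Q3 β x s + P.R3 v x s + P.Binv z x s

end Params

/-- A function that is `C¹` on the closed half-strip `[0, A] × [0, ∞)` agrees there with a globally
continuous function whose partial derivatives on the half-strip are given by globally continuous
functions. -/
theorem exists_continuous_extension_of_contDiffOn {A : ℝ} (hA : 0 < A) {w : ℝ → ℝ → ℝ}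
    (hw : ContDiffOn ℝ 1 (fun p : ℝ × ℝ => w p.1 p.2) (Icc 0 A ×ˢ Ici 0)) :
    ∃ u ut ux : ℝ → ℝ → ℝ, Continuous (Function.uncurry u) ∧ Continuous (Function.uncurry ut) ∧
      Continuous (Function.uncurry ux) ∧ (∀ x ∈ Icc 0 A, ∀ t ≥ 0, u x t = w x t) ∧
      (∀ x ∈ Icc 0 A, ∀ t > 0, HasDerivAt (u x) (ut x t) t) ∧
      (∀ x ∈ Ioo 0 A, ∀ t ≥ 0, HasDerivAt (fun y => u y t) (ux x t) x) ∧
      (∀ x ∈ Icc 0 A, ∀ t > 0, deriv (w x) t = ut x t) ∧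
      (∀ x ∈ Ioo 0 A, ∀ t ≥ 0, deriv (fun y => w y t) x = ux x t) := by
  set S : Set (ℝ × ℝ) := Icc 0 A ×ˢ Ici 0 with hS
  set W : ℝ × ℝ → ℝ := fun p => w p.1 p.2 with hW
  set pr : ℝ × ℝ → ℝ × ℝ := fun p => (max 0 (min A p.1), max 0 p.2) with hpr
  have hprc : Continuous pr := by fun_prop
  have hprS : ∀ p, pr p ∈ S := fun p =>
    ⟨⟨le_max_left _ _, max_le hA.le (min_le_left _ _)⟩, (le_max_left _ _ : (0 : ℝ) ≤ max 0 p.2)⟩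
  have hprid : ∀ x ∈ Icc 0 A, ∀ t ≥ 0, pr (x, t) = (x, t) := by
    intro x hx t ht
    simp only [hpr, min_eq_right hx.2, max_eq_right hx.1, max_eq_right ht]
  have hf' : ContinuousOn (fderivWithin ℝ W S) S :=
    hw.continuousOn_fderivWithin ((uniqueDiffOn_Icc hA).prod (uniqueDiffOn_Ici 0)) le_rfl
  have hfc : Continuous fun p => fderivWithin ℝ W S (pr p) := hf'.comp_continuous hprc hprS
  have hfd : ∀ p ∈ S, HasFDerivWithinAt W (fderivWithin ℝ W S p) S p := fun p hp =>
    (hw.differentiableOn one_ne_zero p hp).hasFDerivWithinAt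
  have hwt : ∀ x ∈ Icc 0 A, ∀ t > 0,
      HasDerivAt (w x) (fderivWithin ℝ W S (pr (x, t)) (0, 1)) t := by
    intro x hx t ht
    rw [hprid x hx t (le_of_lt ht)]
    have h1 : HasDerivWithinAt (fun τ : ℝ => (x, τ)) ((0 : ℝ), (1 : ℝ)) (Ici 0) t :=
      ((hasDerivAt_const t x).prodMk (hasDerivAt_id t)).hasDerivWithinAt
    have h2 := (hfd (x, t) ⟨hx, le_of_lt ht⟩).comp_hasDerivWithinAt (s := Ici 0) t h1
      (fun τ hτ => mk_mem_prod hx hτ)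
    exact h2.hasDerivAt (Ici_mem_nhds ht)
  have hwx : ∀ x ∈ Ioo 0 A, ∀ t ≥ 0,
      HasDerivAt (fun y => w y t) (fderivWithin ℝ W S (pr (x, t)) (1, 0)) x := by
    intro x hx t ht
    rw [hprid x (Ioo_subset_Icc_self hx) t ht]
    have h1 : HasDerivWithinAt (fun y : ℝ => (y, t)) ((1 : ℝ), (0 : ℝ)) (Icc 0 A) x :=
      ((hasDerivAt_id x).prodMk (hasDerivAt_const x t)).hasDerivWithinAt
    have h2 := (hfd (x, t) ⟨Ioo_subset_Icc_self hx, ht⟩).comp_hasDerivWithinAt (s := Icc 0 A) x h1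
      (fun y hy => mk_mem_prod hy ht)
    exact h2.hasDerivAt (Icc_mem_nhds hx.1 hx.2)
  have hu : ∀ x ∈ Icc 0 A, ∀ t ≥ 0, W (pr (x, t)) = w x t := fun x hx t ht => by
    rw [hprid x hx t ht]
  refine ⟨fun x t => W (pr (x, t)), fun x t => fderivWithin ℝ W S (pr (x, t)) (0, 1),
    fun x t => fderivWithin ℝ W S (pr (x, t)) (1, 0),
    hw.continuousOn.comp_continuous hprc hprS, hfc.clm_apply continuous_const,
    hfc.clm_apply continuous_const, hu, fun x hx t ht => ?_, fun x hx t ht => ?_,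
    fun x hx t ht => (hwt x hx t ht).deriv, fun x hx t ht => (hwx x hx t ht).deriv⟩
  · refine (hwt x hx t ht).congr_of_eventuallyEq ?_
    filter_upwards [Ici_mem_nhds ht] with τ hτ using hu x hx τ hτ
  · refine (hwx x hx t ht).congr_of_eventuallyEq ?_
    filter_upwards [Icc_mem_nhds hx.1 hx.2] with y hy using hu y hy t ht

/-- Exponentially weighted `L²` energy identity for the transport equation `u_t = a u_x + g`. -/
theorem hasDerivAt_weighted_energy {A a μ t : ℝ} (hA : 0 < A) (ht : 0 < t)
    {u ut ux : ℝ → ℝ → ℝ} {g : ℝ → ℝ} (hu : Continuous (Function.uncurry u))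
    (hut : Continuous (Function.uncurry ut)) (hux : Continuous (Function.uncurry ux))
    (hg : Continuous g)
    (hdt : ∀ x ∈ Icc 0 A, ∀ t > 0, HasDerivAt (u x) (ut x t) t)
    (hdx : ∀ x ∈ Ioo 0 A, HasDerivAt (fun y => u y t) (ux x t) x)
    (hpde : ∀ x ∈ Ioo 0 A, ut x t = a * ux x t + g x) :
    HasDerivAt (fun τ => ∫ x in (0:ℝ)..A, Real.exp (μ * x) * u x τ ^ 2)
      (a * (Real.exp (μ * A) * u A t ^ 2 - u 0 t ^ 2)
        - a * μ * (∫ x in (0:ℝ)..A, Real.exp (μ * x) * u x t ^ 2)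
        + ∫ x in (0:ℝ)..A, Real.exp (μ * x) * (2 * u x t * g x)) t := by
  have huc : ∀ τ, Continuous fun x => u x τ := fun τ =>
    hu.comp (continuous_id.prodMk continuous_const)
  have hutc : ∀ τ, Continuous fun x => ut x τ := fun τ =>
    hut.comp (continuous_id.prodMk continuous_const)
  have huxc : ∀ τ, Continuous fun x => ux x τ := fun τ =>
    hux.comp (continuous_id.prodMk continuous_const)
  obtain ⟨C, hC⟩ := (isCompact_Icc.prod isCompact_Icc :
      IsCompact (Icc 0 A ×ˢ Icc (t / 2) (2 * t))).exists_bound_of_continuousOn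
    (f := fun p : ℝ × ℝ => Real.exp (μ * p.1) * (2 * u p.1 p.2 * ut p.1 p.2)) <| by
      have h1 : Continuous fun p : ℝ × ℝ => u p.1 p.2 := hu
      have h2 : Continuous fun p : ℝ × ℝ => ut p.1 p.2 := hut
      fun_prop
  have huIoc : uIoc 0 A ⊆ Icc 0 A := by
    rw [uIoc_of_le hA.le]; exact Ioc_subset_Icc_self
  have key := (intervalIntegral.hasDerivAt_integral_of_dominated_loc_of_deriv_le (μ := volume)
    (a := 0) (b := A) (F := fun τ x => Real.exp (μ * x) * u x τ ^ 2)
    (F' := fun τ x => Real.exp (μ * x) * (2 * u x τ * ut x τ)) (bound := fun _ => C)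
    (s := Icc (t / 2) (2 * t)) (x₀ := t) (Icc_mem_nhds (by linarith) (by linarith))
    (Filter.Eventually.of_forall fun τ => by
      have := huc τ
      exact Continuous.aestronglyMeasurable (by fun_prop))
    (by have := huc t; exact Continuous.intervalIntegrable (by fun_prop) _ _)
    (by have := huc t; have := hutc t; exact Continuous.aestronglyMeasurable (by fun_prop))
    (Filter.Eventually.of_forall fun x hx τ hτ => hC (x, τ) ⟨huIoc hx, hτ⟩)
    (by simp)
    (Filter.Eventually.of_forall fun x hx τ hτ => by
      have h := ((hdt x (huIoc hx) τ (lt_of_lt_of_le (by linarith) hτ.1)).pow 2).const_mul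
        (Real.exp (μ * x))
      refine h.congr_deriv ?_
      push_cast
      ring)).2
  refine key.congr_deriv ?_
  have hu1 := huc t
  have hu2 := huxc t
  have hftc : ∫ x in (0:ℝ)..A, (μ * (Real.exp (μ * x) * u x t ^ 2)
      + Real.exp (μ * x) * (2 * u x t * ux x t)) =
      Real.exp (μ * A) * u A t ^ 2 - Real.exp (μ * 0) * u 0 t ^ 2 := by
    refine intervalIntegral.integral_eq_sub_of_hasDerivAt_of_le hA.le
      (f := fun x => Real.exp (μ * x) * u x t ^ 2) (Continuous.continuousOn (by fun_prop))
      (fun x hx => ?_) (Continuous.intervalIntegrable (by fun_prop) _ _)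
    have h := (((hasDerivAt_id x).const_mul μ).exp).mul ((hdx x hx).pow 2)
    refine h.congr_deriv ?_
    simp only [id, Pi.pow_apply]
    push_cast
    ring
  have hcongr : ∫ x in (0:ℝ)..A, Real.exp (μ * x) * (2 * u x t * ut x t) =
      ∫ x in (0:ℝ)..A, (a * (μ * (Real.exp (μ * x) * u x t ^ 2)
        + Real.exp (μ * x) * (2 * u x t * ux x t))
        - a * μ * (Real.exp (μ * x) * u x t ^ 2) + Real.exp (μ * x) * (2 * u x t * g x)) := by
    refine intervalIntegral.integral_congr_uIoo fun x hx => ?_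
    rw [uIoo_of_le hA.le] at hx
    simp only [hpde x hx]
    ring
  rw [hcongr, intervalIntegral.integral_add (Continuous.intervalIntegrable (by fun_prop) _ _)
    (Continuous.intervalIntegrable (by fun_prop) _ _),
    intervalIntegral.integral_sub (Continuous.intervalIntegrable (by fun_prop) _ _)
    (Continuous.intervalIntegrable (by fun_prop) _ _), intervalIntegral.integral_const_mul,
    intervalIntegral.integral_const_mul, hftc]
  simp

/-- Solutions of `w_t = w_s` are constant along characteristics. -/
theorem transport_const_along_characteristics {D : ℝ} {w : ℝ → ℝ → ℝ}
    (hw : ContDiffOn ℝ 1 (fun p : ℝ × ℝ => w p.1 p.2) (Icc 0 D ×ˢ Ici 0))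
    (hpde : ∀ s ∈ Ioo 0 D, ∀ t > 0, deriv (w s) t = deriv (fun s' => w s' t) s)
    {s t r : ℝ} (hs : 0 ≤ s) (hr : 0 ≤ r) (ht : 0 ≤ t) (hD : s + r ≤ D) :
    w s (t + r) = w (s + r) t := by
  have hcont : ContinuousOn (fun τ => w (s + r - τ) (t + τ)) (Icc 0 r) :=
    hw.continuousOn.comp (f := fun τ => (s + r - τ, t + τ)) (by fun_prop) fun τ hτ =>
      ⟨⟨by linarith [hτ.2], by linarith [hτ.1]⟩, add_nonneg ht hτ.1⟩
  have hderiv : ∀ τ ∈ interior (Icc 0 r), HasDerivAt (fun τ => w (s + r - τ) (t + τ)) 0 τ := by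
    intro τ hτ
    rw [interior_Icc] at hτ
    have hs1 : s + r - τ ∈ Ioo 0 D := ⟨by linarith [hτ.2], by linarith [hτ.1]⟩
    have ht1 : 0 < t + τ := by linarith [hτ.1]
    have hd : HasFDerivAt (fun p : ℝ × ℝ => w p.1 p.2) _ (s + r - τ, t + τ) :=
      ((hw.contDiffAt (prod_mem_nhds (Icc_mem_nhds hs1.1 hs1.2) (Ici_mem_nhds ht1))
        ).differentiableAt one_ne_zero).hasFDerivAt
    have h1 := (hd.comp_hasDerivAt (t + τ)
      ((hasDerivAt_const (t + τ) (s + r - τ)).prodMk (hasDerivAt_id (t + τ)))).deriv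
    have h2 := (hd.comp_hasDerivAt (s + r - τ)
      ((hasDerivAt_id (s + r - τ)).prodMk (hasDerivAt_const (s + r - τ) (t + τ)))).deriv
    have h3 := hd.comp_hasDerivAt τ
      (((hasDerivAt_id τ).const_sub (s + r)).prodMk ((hasDerivAt_id τ).const_add t))
    refine h3.congr_deriv ?_
    have h4 := hpde _ hs1 _ ht1
    have h5 : ((-1 : ℝ), (1 : ℝ)) = ((0 : ℝ), (1 : ℝ)) - ((1 : ℝ), (0 : ℝ)) := by simp
    rw [h5, map_sub, sub_eq_zero]
    exact h1.symm.trans (h4.trans h2)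
  have h0 : (0:ℝ) ∈ Icc 0 r := ⟨le_rfl, hr⟩
  have h1 : r ∈ Icc 0 r := ⟨hr, le_rfl⟩
  have hanti := antitoneOn_of_deriv_nonpos (convex_Icc 0 r) hcont
    (fun τ hτ => (hderiv τ hτ).differentiableAt.differentiableWithinAt)
    (fun τ hτ => (hderiv τ hτ).deriv.le) h0 h1 hr
  have hmono := monotoneOn_of_deriv_nonneg (convex_Icc 0 r) hcont
    (fun τ hτ => (hderiv τ hτ).differentiableAt.differentiableWithinAt)
    (fun τ hτ => (hderiv τ hτ).deriv.ge) h0 h1 hr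
  simpa using le_antisymm hanti hmono

/-- Gronwall-type estimate with a source term that vanishes after time `D`. -/
theorem exp_mul_le_of_hasDerivAt_le {E G : ℝ → ℝ} {θ K D : ℝ} (hE : Continuous E)
    (hG : Continuous G) (hθ : 0 ≤ θ) (hK : 0 ≤ K) (hG0 : ∀ t, 0 ≤ G t)
    (hGD : ∀ t ≥ D, G t = 0)
    (hE' : ∀ t > 0, ∃ E', HasDerivAt E E' t ∧ E' ≤ -θ * E t + K * G t) {t : ℝ} (ht : 0 ≤ t) :
    Real.exp (θ * t) * E t ≤ E 0 + K * (Real.exp (θ * D) * ∫ τ in (0:ℝ)..D, G τ) := by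
  have hcont : Continuous fun τ => Real.exp (θ * τ) * G τ := by fun_prop
  have hH : ∀ t > 0, ∃ H', HasDerivAt
      (fun t => Real.exp (θ * t) * E t - K * ∫ τ in (0:ℝ)..t, Real.exp (θ * τ) * G τ) H' t ∧
      H' ≤ 0 := by
    intro t ht
    obtain ⟨E', h1, h2⟩ := hE' t ht
    have hi : HasDerivAt (fun t => ∫ τ in (0:ℝ)..t, Real.exp (θ * τ) * G τ)
        (Real.exp (θ * t) * G t) t :=
      intervalIntegral.integral_hasDerivAt_right (hcont.intervalIntegrable _ _)
        hcont.stronglyMeasurable.stronglyMeasurableAtFilter hcont.continuousAt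
    refine ⟨_, ((((hasDerivAt_id t).const_mul θ).exp).mul h1).sub (hi.const_mul K), ?_⟩
    simp only [id]
    have := mul_le_mul_of_nonneg_left h2 (Real.exp_pos (θ * t)).le
    linarith
  have hanti := antitoneOn_of_deriv_nonpos (convex_Ici (0:ℝ))
    (f := fun t => Real.exp (θ * t) * E t - K * ∫ τ in (0:ℝ)..t, Real.exp (θ * τ) * G τ)
    (Continuous.continuousOn <| by
      have := intervalIntegral.continuous_primitive (μ := volume)
        (fun a b => hcont.intervalIntegrable a b) 0
      fun_prop)
    (fun τ hτ => by
      rw [interior_Ici] at hτ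
      obtain ⟨_, h, _⟩ := hH τ hτ
      exact h.differentiableAt.differentiableWithinAt)
    (fun τ hτ => by
      rw [interior_Ici] at hτ
      obtain ⟨_, h, h'⟩ := hH τ hτ
      exact h.deriv.trans_le h') (mem_Ici.2 le_rfl) (mem_Ici.2 ht) ht
  have hexp : ∫ τ in (0:ℝ)..t, Real.exp (θ * τ) * G τ ≤
      ∫ τ in (0:ℝ)..t, Real.exp (θ * D) * G τ := by
    refine intervalIntegral.integral_mono_on ht (hcont.intervalIntegrable _ _)
      (Continuous.intervalIntegrable (by fun_prop) _ _) fun τ _ => ?_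
    rcases le_total D τ with h | h
    · simp [hGD τ h]
    · have := hG0 τ
      gcongr
  have hint : ∫ τ in (0:ℝ)..t, G τ ≤ ∫ τ in (0:ℝ)..D, G τ := by
    rcases le_total t D with h | h
    · exact intervalIntegral.integral_mono_interval le_rfl ht h
        (Filter.Eventually.of_forall hG0) (hG.intervalIntegrable _ _)
    · rw [← intervalIntegral.integral_add_adjacent_intervals (hG.intervalIntegrable 0 D)
        (hG.intervalIntegrable D t)]
      have : ∫ τ in D..t, G τ = ∫ τ in D..t, (0 : ℝ) :=
        intervalIntegral.integral_congr fun τ hτ => by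
          rw [uIcc_of_le h] at hτ
          exact hGD τ hτ.1
      simp [this]
  rw [intervalIntegral.integral_const_mul] at hexp
  have h3 := mul_le_mul_of_nonneg_left (hexp.trans
    (mul_le_mul_of_nonneg_left hint (Real.exp_pos (θ * D)).le)) hK
  simp only [mul_zero, Real.exp_zero, one_mul, intervalIntegral.integral_same, sub_zero] at hanti
  linarith

/-- Bound on the source terms of the `z`-equation, tested against `exp (-μ x) z`. -/
theorem weighted_source_z_le {L μ b c d c2 : ℝ} (hL : 0 ≤ L) (hμ : 0 ≤ μ) (hc2 : 0 ≤ c2)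
    {z v β : ℝ → ℝ} (hz : Continuous z) (hv : Continuous v) (hβ : Continuous β) :
    ∫ x in (0:ℝ)..L, Real.exp (-μ * x) * (2 * z x *
        (b * z x - c * Real.exp (c2 * x) * β x - d * Real.exp (c2 * x) * v x)) ≤
      (2 * b + 2) * (∫ x in (0:ℝ)..L, Real.exp (-μ * x) * z x ^ 2)
        + (c * Real.exp (c2 * L)) ^ 2 * (∫ x in (0:ℝ)..L, β x ^ 2)
        + (d * Real.exp (c2 * L)) ^ 2 * (∫ x in (0:ℝ)..L, v x ^ 2) := by
  rw [← intervalIntegral.integral_const_mul, ← intervalIntegral.integral_const_mul,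
    ← intervalIntegral.integral_const_mul,
    ← intervalIntegral.integral_add (Continuous.intervalIntegrable (by fun_prop) _ _)
      (Continuous.intervalIntegrable (by fun_prop) _ _),
    ← intervalIntegral.integral_add (Continuous.intervalIntegrable (by fun_prop) _ _)
      (Continuous.intervalIntegrable (by fun_prop) _ _)]
  refine intervalIntegral.integral_mono_on hL (Continuous.intervalIntegrable (by fun_prop) _ _)
      (Continuous.intervalIntegrable (by fun_prop) _ _) fun x hx => ?_
  have hw0 := Real.exp_pos (-μ * x)
  have hw1 : Real.exp (-μ * x) ≤ 1 := Real.exp_le_one_iff.2 (by nlinarith [hx.1])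
  have he : Real.exp (c2 * x) ^ 2 ≤ Real.exp (c2 * L) ^ 2 := by
    have := hx.2
    gcongr
  set w := Real.exp (-μ * x)
  set e := Real.exp (c2 * x)
  have key : ∀ a y : ℝ, w * (a * e * y) ^ 2 ≤ (a * Real.exp (c2 * L)) ^ 2 * y ^ 2 := fun a y => by
    calc w * (a * e * y) ^ 2 ≤ 1 * (a * e * y) ^ 2 := by gcongr
      _ = a ^ 2 * y ^ 2 * e ^ 2 := by ring
      _ ≤ a ^ 2 * y ^ 2 * Real.exp (c2 * L) ^ 2 := by gcongr
      _ = _ := by ring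
  have h1 := key c (β x)
  have h2 := key d (v x)
  have h3 := mul_nonneg hw0.le (sq_nonneg (z x + c * e * β x))
  have h4 := mul_nonneg hw0.le (sq_nonneg (z x + d * e * v x))
  linarith

/-- Bound on the source terms of the `v`-equation, tested against `exp (ν x) v`. -/
theorem weighted_source_v_le {L ν c k : ℝ} (hL : 0 ≤ L) (hν : 0 ≤ ν) (hk : 0 ≤ k)
    {v β : ℝ → ℝ} (hv : Continuous v) (hβ : Continuous β) :
    ∫ x in (0:ℝ)..L, Real.exp (ν * x) * (2 * v x * (-c * β x - k * v x)) ≤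
      (∫ x in (0:ℝ)..L, Real.exp (ν * x) * v x ^ 2)
        + c ^ 2 * Real.exp (ν * L) * (∫ x in (0:ℝ)..L, β x ^ 2) := by
  rw [← intervalIntegral.integral_const_mul,
    ← intervalIntegral.integral_add (Continuous.intervalIntegrable (by fun_prop) _ _)
      (Continuous.intervalIntegrable (by fun_prop) _ _)]
  refine intervalIntegral.integral_mono_on hL (Continuous.intervalIntegrable (by fun_prop) _ _)
      (Continuous.intervalIntegrable (by fun_prop) _ _) fun x hx => ?_
  have hw0 := Real.exp_pos (ν * x)
  have he : Real.exp (ν * x) ≤ Real.exp (ν * L) := by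
    have := hx.2
    gcongr
  have h1 : c ^ 2 * β x ^ 2 * Real.exp (ν * x) ≤ c ^ 2 * β x ^ 2 * Real.exp (ν * L) := by gcongr
  have h3 := mul_nonneg hw0.le (sq_nonneg (v x + c * β x))
  have h4 := mul_nonneg hw0.le (mul_nonneg hk (sq_nonneg (v x)))
  linarith

/-- Comparison of weighted and unweighted `L²` norms. -/
theorem integral_exp_mul_sq_bounds {L ν : ℝ} (hL : 0 ≤ L) (hν : 0 ≤ ν) {f : ℝ → ℝ}
    (hf : Continuous f) :
    (∫ x in (0:ℝ)..L, f x ^ 2) ≤ (∫ x in (0:ℝ)..L, Real.exp (ν * x) * f x ^ 2) ∧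
    (∫ x in (0:ℝ)..L, Real.exp (ν * x) * f x ^ 2) ≤
      Real.exp (ν * L) * ∫ x in (0:ℝ)..L, f x ^ 2 := by
  refine ⟨intervalIntegral.integral_mono_on hL (Continuous.intervalIntegrable (by fun_prop) _ _)
    (Continuous.intervalIntegrable (by fun_prop) _ _) fun x hx => ?_, ?_⟩
  · exact le_mul_of_one_le_left (sq_nonneg _) (Real.one_le_exp (mul_nonneg hν hx.1))
  · rw [← intervalIntegral.integral_const_mul]
    refine intervalIntegral.integral_mono_on hL (Continuous.intervalIntegrable (by fun_prop) _ _)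
      (Continuous.intervalIntegrable (by fun_prop) _ _) fun x hx => ?_
    have := hx.2
    gcongr

theorem integral_exp_neg_mul_sq_bounds {L μ : ℝ} (hL : 0 ≤ L) (hμ : 0 ≤ μ) {f : ℝ → ℝ}
    (hf : Continuous f) :
    (∫ x in (0:ℝ)..L, f x ^ 2) ≤
      Real.exp (μ * L) * (∫ x in (0:ℝ)..L, Real.exp (-μ * x) * f x ^ 2) ∧
    (∫ x in (0:ℝ)..L, Real.exp (-μ * x) * f x ^ 2) ≤ ∫ x in (0:ℝ)..L, f x ^ 2 := by
  constructor
  · rw [← intervalIntegral.integral_const_mul]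
    refine intervalIntegral.integral_mono_on hL (Continuous.intervalIntegrable (by fun_prop) _ _)
      (Continuous.intervalIntegrable (by fun_prop) _ _) fun x hx => ?_
    rw [← mul_assoc, ← Real.exp_add]
    exact le_mul_of_one_le_left (sq_nonneg _) (Real.one_le_exp (by nlinarith [hx.2]))
  · refine intervalIntegral.integral_mono_on hL (Continuous.intervalIntegrable (by fun_prop) _ _)
      (Continuous.intervalIntegrable (by fun_prop) _ _) fun x hx => ?_
    exact mul_le_of_le_one_left (sq_nonneg _) (Real.exp_le_one_iff.2 (by nlinarith [hx.1]))

/-- Fubini for a continuous function on a rectangle. -/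
theorem intervalIntegral_swap_of_continuous {f : ℝ → ℝ → ℝ} (hf : Continuous (Function.uncurry f))
    {a b c d : ℝ} (hab : a ≤ b) (hcd : c ≤ d) :
    ∫ x in a..b, ∫ y in c..d, f x y = ∫ y in c..d, ∫ x in a..b, f x y := by
  simp only [intervalIntegral.integral_of_le hab, intervalIntegral.integral_of_le hcd]
  refine integral_integral_swap ?_
  rw [Measure.prod_restrict]
  exact (hf.continuousOn.integrableOn_compact (isCompact_Icc.prod isCompact_Icc)).mono_set
    (prod_mono Ioc_subset_Icc_self Ioc_subset_Icc_self)

/-- A function of `s ∈ [0, D]` obtained by shifting `f₀` by `t` and discarding what leaves `[0, D]`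
has `L²` norm at most that of `f₀`, and vanishes for `t ≥ D`. -/
theorem integral_sq_shift_le {D t θ : ℝ} {f f₀ : ℝ → ℝ} (hf : Continuous f) (hf₀ : Continuous f₀)
    (hD : 0 ≤ D) (ht : 0 ≤ t) (hθ : 0 ≤ θ) (h1 : ∀ s ∈ Icc 0 D, s + t ≤ D → f s = f₀ (s + t))
    (h2 : ∀ s ∈ Icc 0 D, D ≤ s + t → f s = 0) :
    ∫ s in (0:ℝ)..D, f s ^ 2 ≤
      Real.exp (θ * D) * Real.exp (-θ * t) * ∫ s in (0:ℝ)..D, f₀ s ^ 2 := by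
  have hi : ∀ {g : ℝ → ℝ}, Continuous g → ∀ a b, IntervalIntegrable (fun s => g s ^ 2) volume a b :=
    fun hg a b => (hg.pow 2).intervalIntegrable a b
  have hpos : 0 ≤ ∫ s in (0:ℝ)..D, f₀ s ^ 2 :=
    intervalIntegral.integral_nonneg hD fun s _ => sq_nonneg _
  rcases le_total D t with h | h
  · have : ∫ s in (0:ℝ)..D, f s ^ 2 = ∫ s in (0:ℝ)..D, (0:ℝ) :=
      intervalIntegral.integral_congr fun s hs => by
        rw [uIcc_of_le hD] at hs
        simp [h2 s hs (by linarith [hs.1])]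
    rw [this, intervalIntegral.integral_zero]
    positivity
  · have e1 : ∫ s in (0:ℝ)..(D - t), f s ^ 2 = ∫ s in (0:ℝ)..(D - t), f₀ (s + t) ^ 2 :=
      intervalIntegral.integral_congr fun s hs => by
        rw [uIcc_of_le (by linarith)] at hs
        rw [h1 s ⟨hs.1, by linarith [hs.2]⟩ (by linarith [hs.2])]
    have e2 : ∫ s in (D - t)..D, f s ^ 2 = ∫ s in (D - t)..D, (0:ℝ) :=
      intervalIntegral.integral_congr fun s hs => by
        rw [uIcc_of_le (by linarith)] at hs
        simp [h2 s ⟨by linarith [hs.1], hs.2⟩ (by linarith [hs.1])]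
    rw [← intervalIntegral.integral_add_adjacent_intervals (hi hf 0 (D - t)) (hi hf (D - t) D),
      e1, e2, intervalIntegral.integral_zero, add_zero,
      intervalIntegral.integral_comp_add_right (fun s => f₀ s ^ 2), zero_add, sub_add_cancel]
    calc ∫ s in t..D, f₀ s ^ 2 ≤ ∫ s in (0:ℝ)..D, f₀ s ^ 2 :=
          intervalIntegral.integral_mono_interval ht h le_rfl
            (Filter.Eventually.of_forall fun s => sq_nonneg _) (hi hf₀ 0 D)
      _ ≤ _ := le_mul_of_one_le_left hpos <| by
          rw [← Real.exp_add]
          exact Real.one_le_exp (by nlinarith)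

/-- A function that is `C¹` on `[0, L] × [0, D] × [0, ∞)`, satisfies `β_t = β_s` in the interior
and vanishes at `s = D` has a globally continuous extension that is constant along characteristics
and vanishes for `s + t ≥ D`. -/
theorem exists_continuous_extension_of_transport {L D : ℝ} (hL : 0 < L) (hD : 0 < D)
    {β : ℝ → ℝ → ℝ → ℝ}
    (hβ : ContDiffOn ℝ 1 (fun p : ℝ × ℝ × ℝ => β p.1 p.2.1 p.2.2)
      (Icc 0 L ×ˢ Icc 0 D ×ˢ Ici 0))
    (hpde : ∀ x ∈ Ioo (0:ℝ) L, ∀ s ∈ Ioo (0:ℝ) D, ∀ t > (0:ℝ),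
      deriv (fun t' => β x s t') t = deriv (fun s' => β x s' t) s)
    (hbc : ∀ x ∈ Icc (0:ℝ) L, ∀ t ≥ (0:ℝ), β x D t = 0) :
    ∃ b : ℝ → ℝ → ℝ → ℝ, Continuous (fun p : ℝ × ℝ × ℝ => b p.1 p.2.1 p.2.2) ∧
      (∀ x ∈ Icc 0 L, ∀ s ∈ Icc 0 D, ∀ t ≥ 0, b x s t = β x s t) ∧
      (∀ x ∈ Icc 0 L, ∀ s ∈ Icc 0 D, ∀ t ≥ 0, s + t ≤ D → b x s t = b x (s + t) 0) ∧
      (∀ x ∈ Icc 0 L, ∀ s ∈ Icc 0 D, ∀ t ≥ 0, D ≤ s + t → b x s t = 0) := by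
  set pr : ℝ × ℝ × ℝ → ℝ × ℝ × ℝ :=
    fun p => (max 0 (min L p.1), max 0 (min D p.2.1), max 0 p.2.2) with hpr
  have hprc : Continuous pr := by fun_prop
  have hprS : ∀ p, pr p ∈ Icc 0 L ×ˢ Icc 0 D ×ˢ Ici 0 := fun p =>
    ⟨⟨le_max_left _ _, max_le hL.le (min_le_left _ _)⟩,
      ⟨le_max_left _ _, max_le hD.le (min_le_left _ _)⟩, (le_max_left _ _ : (0:ℝ) ≤ max 0 p.2.2)⟩
  obtain ⟨b, hbdef⟩ : ∃ b : ℝ → ℝ → ℝ → ℝ,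
      b = fun x s t => (fun p : ℝ × ℝ × ℝ => β p.1 p.2.1 p.2.2) (pr (x, s, t)) := ⟨_, rfl⟩
  have hb : Continuous (fun p : ℝ × ℝ × ℝ => b p.1 p.2.1 p.2.2) := by
    rw [hbdef]
    exact hβ.continuousOn.comp_continuous hprc hprS
  have hbβ : ∀ x ∈ Icc 0 L, ∀ s ∈ Icc 0 D, ∀ t ≥ 0, b x s t = β x s t := by
    intro x hx s hs t ht
    simp only [hbdef, hpr, min_eq_right hx.2, max_eq_right hx.1, min_eq_right hs.2,
      max_eq_right hs.1, max_eq_right ht]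
  have hchar : ∀ x ∈ Icc 0 L, ∀ s t r : ℝ, 0 ≤ s → 0 ≤ t → 0 ≤ r → s + r ≤ D →
      b x s (t + r) = b x (s + r) t := by
    intro x hx s t r hs ht hr hsr
    have heq : EqOn (fun x => b x s (t + r)) (fun x => b x (s + r) t) (Ioo 0 L) := by
      intro x hx
      have hx' := Ioo_subset_Icc_self hx
      simp only
      rw [hbβ x hx' s ⟨hs, by linarith⟩ _ (by positivity),
        hbβ x hx' (s + r) ⟨by positivity, hsr⟩ t ht]
      exact transport_const_along_characteristics
        (hβ.comp (f := fun p : ℝ × ℝ => (x, p.1, p.2)) (by fun_prop) fun p hp => ⟨hx', hp⟩)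
        (hpde x hx) hs hr ht hsr
    have h := heq.closure
      (hb.comp (continuous_id.prodMk (continuous_const.prodMk continuous_const)))
      (hb.comp (continuous_id.prodMk (continuous_const.prodMk continuous_const)))
    rw [closure_Ioo hL.ne] at h
    exact h hx
  refine ⟨b, hb, hbβ, fun x hx s hs t ht hst => ?_, fun x hx s hs t ht hst => ?_⟩
  · simpa using hchar x hx s 0 t hs.1 le_rfl ht hst
  · have h := hchar x hx s (t - (D - s)) (D - s) hs.1 (by linarith) (by linarith [hs.2])
      (by linarith)
    rw [sub_add_cancel, add_sub_cancel, hbβ x hx D ⟨hD.le, le_rfl⟩ _ (by linarith),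
      hbc x hx _ (by linarith)] at h
    exact h

/-- Exponential stability in `L²` of the target system. -/
theorem target_system_exponential_stability (P : Params) (hP : P.Pos) :
    ∃ N θ : ℝ, 0 < N ∧ 0 < θ ∧
      ∀ (z v : ℝ → ℝ → ℝ) (β : ℝ → ℝ → ℝ → ℝ),
        ContDiffOn ℝ 1 (fun p : ℝ × ℝ => z p.1 p.2) (Icc 0 P.L ×ˢ Ici 0) →
        ContDiffOn ℝ 1 (fun p : ℝ × ℝ => v p.1 p.2) (Icc 0 P.L ×ˢ Ici 0) →
        ContDiffOn ℝ 1 (fun p : ℝ × ℝ × ℝ => β p.1 p.2.1 p.2.2)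
          (Icc 0 P.L ×ˢ Icc 0 P.D ×ˢ Ici 0) →
        (∀ x ∈ Ioo (0:ℝ) P.L, ∀ t > (0:ℝ),
          deriv (fun t' => z x t') t =
            -P.c1 * deriv (fun x' => z x' t) x + P.c1 * P.c2 * z x t
              - P.c3 * Real.exp (P.c2 * x) * β x 0 t
              - P.k * P.c3 / P.c6 * Real.exp (P.c2 * x) * v x t) →
        (∀ x ∈ Ioo (0:ℝ) P.L, ∀ t > (0:ℝ),
          deriv (fun t' => v x t') t =
            P.c4 * deriv (fun x' => v x' t) x - P.c6 * β x 0 t - P.k * v x t) →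
        (∀ t ≥ (0:ℝ), z 0 t = -P.c7 * v 0 t) →
        (∀ t > (0:ℝ),
          deriv (fun t' => v P.L t') t = -P.k * v P.L t - P.c6 * β P.L 0 t) →
        (∀ x ∈ Ioo (0:ℝ) P.L, ∀ s ∈ Ioo (0:ℝ) P.D, ∀ t > (0:ℝ),
          deriv (fun t' => β x s t') t = deriv (fun s' => β x s' t) s) →
        (∀ x ∈ Icc (0:ℝ) P.L, ∀ t ≥ (0:ℝ), β x P.D t = 0) →
        ∀ t > (0:ℝ),
          nX P.L (fun x => z x t) + nX P.L (fun x => v x t) + v P.L t ^ 2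
              + n2 P.L P.D (fun x s => β x s t) + nS P.D (fun s => β P.L s t)
            ≤ N * Real.exp (-θ * t) *
              (nX P.L (fun x => z x 0) + nX P.L (fun x => v x 0) + v P.L 0 ^ 2
                + n2 P.L P.D (fun x s => β x s 0) + nS P.D (fun s => β P.L s 0)) := by
  obtain ⟨L, D, c1, c2, c3, c4, c5, c6, c7, k⟩ := P
  obtain ⟨hL, hD, hc1, hc2, hc3, hc4, -, hc6, hc7, hk, -⟩ := hP
  simp only at hL hD hc1 hc2 hc3 hc4 hc6 hc7 hk ⊢
  obtain ⟨μ, hμ, hμe⟩ : ∃ μ, 0 < μ ∧ c1 * μ = 2 * (c1 * c2) + 3 :=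
    ⟨(2 * (c1 * c2) + 3) / c1, by positivity, by field_simp⟩
  obtain ⟨ν, hν, hνe⟩ : ∃ ν, 0 < ν ∧ c4 * ν = 2 := ⟨2 / c4, by positivity, by field_simp⟩
  obtain ⟨K1, hK1, hK1e⟩ : ∃ K1, 0 ≤ K1 ∧ K1 = (c3 * Real.exp (c2 * L)) ^ 2 :=
    ⟨_, by positivity, rfl⟩
  obtain ⟨K2, hK2, hK2e⟩ : ∃ K2, 0 ≤ K2 ∧ K2 = (k * c3 / c6 * Real.exp (c2 * L)) ^ 2 :=
    ⟨_, by positivity, rfl⟩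
  obtain ⟨M, hM, hMK, hMc⟩ : ∃ M, 1 ≤ M ∧ K2 + 1 ≤ M ∧ c1 * c7 ^ 2 ≤ M * c4 := by
    have h0 : 0 ≤ c1 * c7 ^ 2 / c4 := by positivity
    refine ⟨c1 * c7 ^ 2 / c4 + K2 + 1, by linarith, by linarith, ?_⟩
    have : c1 * c7 ^ 2 / c4 * c4 = c1 * c7 ^ 2 := by field_simp
    nlinarith
  obtain ⟨Λ, hΛ, hΛe⟩ : ∃ Λ, 0 < Λ ∧ Λ = Real.exp (ν * L) := ⟨_, Real.exp_pos _, rfl⟩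
  obtain ⟨R, hR, hRk⟩ : ∃ R, 1 ≤ R ∧ M * (c4 * Λ) + 1 ≤ k * R := by
    have h0 : 0 ≤ (M * (c4 * Λ) + 1) / k := by positivity
    refine ⟨(M * (c4 * Λ) + 1) / k + 1, by linarith, ?_⟩
    have : k * ((M * (c4 * Λ) + 1) / k) = M * (c4 * Λ) + 1 := by field_simp
    linarith
  obtain ⟨K, hK, hKB, hKL⟩ : ∃ K, 0 ≤ K ∧ K1 + M * (c6 ^ 2 * Λ) ≤ K ∧ R * (c6 ^ 2 / k) ≤ K := by
    have h1 : 0 ≤ K1 + M * (c6 ^ 2 * Λ) := by positivity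
    have h2 : 0 ≤ R * (c6 ^ 2 / k) := by positivity
    exact ⟨(K1 + M * (c6 ^ 2 * Λ)) + R * (c6 ^ 2 / k), by linarith, by linarith, by linarith⟩
  obtain ⟨θ, hθ, hθ1, hθM, hθR⟩ : ∃ θ, 0 < θ ∧ θ ≤ 1 ∧ θ * M ≤ 1 ∧ θ * R ≤ 1 := by
    have h0 : 0 < 1 + M + R := by linarith
    refine ⟨(1 + M + R)⁻¹, by positivity, inv_le_one_of_one_le₀ (by linarith), ?_, ?_⟩ <;>
    · rw [inv_mul_le_iff₀ h0]
      linarith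
  set C0 := Real.exp (μ * L) with hC0
  have hC0' : 1 ≤ C0 := Real.one_le_exp (by positivity)
  refine ⟨C0 * (1 + M * Λ + R) + C0 * K * Real.exp (θ * D) + Real.exp (θ * D), θ, by positivity,
    hθ, ?_⟩
  intro z v β hz hv hβ hzpde hvpde hz0 hvL hβpde hβD t ht
  obtain ⟨z', zt, zx, hzc, hztc, hzxc, hze, hzt, hzx, hzdt, hzdx⟩ :=
    exists_continuous_extension_of_contDiffOn hL hz
  obtain ⟨v', vt, vx, hvc, hvtc, hvxc, hve, hvt, hvx, hvdt, hvdx⟩ :=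
    exists_continuous_extension_of_contDiffOn hL hv
  obtain ⟨b, hbc, hbe, hb1, hb2⟩ :=
    exists_continuous_extension_of_transport hL hD hβ hβpde hβD
  have h0D : (0:ℝ) ∈ Icc 0 D := ⟨le_rfl, hD.le⟩
  have h0L : (0:ℝ) ∈ Icc 0 L := ⟨le_rfl, hL.le⟩
  have hLL : L ∈ Icc 0 L := ⟨hL.le, le_rfl⟩
  have nXz : ∀ t ≥ 0, nX L (fun x => z x t) = ∫ x in (0:ℝ)..L, z' x t ^ 2 := fun t ht =>
    intervalIntegral.integral_congr fun x hx => by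
      rw [uIcc_of_le hL.le] at hx
      simp only [hze x hx t ht]
  have nXv : ∀ t ≥ 0, nX L (fun x => v x t) = ∫ x in (0:ℝ)..L, v' x t ^ 2 := fun t ht =>
    intervalIntegral.integral_congr fun x hx => by
      rw [uIcc_of_le hL.le] at hx
      simp only [hve x hx t ht]
  have nSb : ∀ x ∈ Icc 0 L, ∀ t ≥ 0, nS D (fun s => β x s t) = ∫ s in (0:ℝ)..D, b x s t ^ 2 :=
    fun x hx t ht => intervalIntegral.integral_congr fun s hs => by
      rw [uIcc_of_le hD.le] at hs
      simp only [hbe x hx s hs t ht]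
  have n2b : ∀ t ≥ 0, n2 L D (fun x s => β x s t) =
      ∫ x in (0:ℝ)..L, ∫ s in (0:ℝ)..D, b x s t ^ 2 := fun t ht =>
    intervalIntegral.integral_congr fun x hx => by
      rw [uIcc_of_le hL.le] at hx
      exact nSb x hx t ht
  rw [nXz t ht.le, nXz 0 le_rfl, nXv t ht.le, nXv 0 le_rfl, n2b t ht.le, n2b 0 le_rfl,
    nSb L hLL t ht.le, nSb L hLL 0 le_rfl, ← hve L hLL t ht.le, ← hve L hLL 0 le_rfl]
  have hbs : ∀ x t, Continuous fun s => b x s t := fun x t =>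
    hbc.comp (continuous_const.prodMk (continuous_id.prodMk continuous_const))
  have hbx : ∀ s t, Continuous fun x => b x s t := fun s t =>
    hbc.comp (continuous_id.prodMk (continuous_const.prodMk continuous_const))
  have hzX : ∀ t, Continuous fun x => z' x t := fun t =>
    hzc.comp (continuous_id.prodMk continuous_const)
  have hvX : ∀ t, Continuous fun x => v' x t := fun t =>
    hvc.comp (continuous_id.prodMk continuous_const)
  have hβdecay : ∀ x ∈ Icc 0 L, ∫ s in (0:ℝ)..D, b x s t ^ 2 ≤
      Real.exp (θ * D) * Real.exp (-θ * t) * ∫ s in (0:ℝ)..D, b x s 0 ^ 2 := fun x hx =>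
    integral_sq_shift_le (hbs x t) (hbs x 0) hD.le ht.le hθ.le
      (fun s hs => hb1 x hx s hs t ht.le) (fun s hs => hb2 x hx s hs t ht.le)
  have hparam : ∀ t, Continuous fun x => ∫ s in (0:ℝ)..D, b x s t ^ 2 := fun t => by
    refine intervalIntegral.continuous_parametric_intervalIntegral_of_continuous'
      (f := fun x s => b x s t ^ 2) ?_ _ _
    exact (hbc.comp (continuous_fst.prodMk (continuous_snd.prodMk continuous_const))).pow 2
  have hβdecay2 : ∫ x in (0:ℝ)..L, ∫ s in (0:ℝ)..D, b x s t ^ 2 ≤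
      Real.exp (θ * D) * Real.exp (-θ * t) * ∫ x in (0:ℝ)..L, ∫ s in (0:ℝ)..D, b x s 0 ^ 2 := by
    rw [← intervalIntegral.integral_const_mul]
    exact intervalIntegral.integral_mono_on hL.le ((hparam t).intervalIntegrable _ _)
      (((hparam 0).const_mul _).intervalIntegrable _ _) hβdecay
  have hβdecayL := hβdecay L hLL
  set G : ℝ → ℝ := fun τ => (∫ x in (0:ℝ)..L, b x 0 τ ^ 2) + b L 0 τ ^ 2 with hG
  have hcurry : ∀ {f : ℝ → ℝ → ℝ}, Continuous (Function.uncurry f) →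
      Continuous (Function.uncurry fun t x => f x t) := fun hf => hf.comp continuous_swap
  have hb0c : Continuous (Function.uncurry fun x τ => b x 0 τ) :=
    hbc.comp (continuous_fst.prodMk (continuous_const.prodMk continuous_snd))
  have hb0sq : Continuous (Function.uncurry fun τ x => b x 0 τ ^ 2) := (hcurry hb0c).pow 2
  have hGI : Continuous fun τ => ∫ x in (0:ℝ)..L, b x 0 τ ^ 2 :=
    intervalIntegral.continuous_parametric_intervalIntegral_of_continuous'
      hb0sq _ _
  have hbL0 : Continuous fun τ => b L 0 τ :=
    hb0c.comp (continuous_const.prodMk continuous_id)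
  have hGc : Continuous G := hGI.add (hbL0.pow 2)
  have hGnn : ∀ τ, 0 ≤ G τ := fun τ =>
    add_nonneg (intervalIntegral.integral_nonneg hL.le fun x _ => sq_nonneg _) (sq_nonneg _)
  have hGD : ∀ τ ≥ D, G τ = 0 := fun τ hτ => by
    have h1 : ∫ x in (0:ℝ)..L, b x 0 τ ^ 2 = ∫ x in (0:ℝ)..L, (0:ℝ) :=
      intervalIntegral.integral_congr fun x hx => by
        rw [uIcc_of_le hL.le] at hx
        simp [hb2 x hx 0 h0D τ (hD.le.trans hτ) (by linarith)]
    simp only [hG, h1, hb2 L hLL 0 h0D τ (hD.le.trans hτ) (by linarith)]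
    simp
  have hGint : ∫ τ in (0:ℝ)..D, G τ =
      (∫ x in (0:ℝ)..L, ∫ s in (0:ℝ)..D, b x s 0 ^ 2) + ∫ s in (0:ℝ)..D, b L s 0 ^ 2 := by
    have hb0 : ∀ x ∈ Icc 0 L, ∀ τ ∈ Icc 0 D, b x 0 τ = b x τ 0 := fun x hx τ hτ => by
      simpa using hb1 x hx 0 h0D τ hτ.1 (by simpa using hτ.2)
    have hb0' : ∀ x ∈ Icc 0 L, ∫ τ in (0:ℝ)..D, b x 0 τ ^ 2 = ∫ s in (0:ℝ)..D, b x s 0 ^ 2 :=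
      fun x hx => intervalIntegral.integral_congr fun τ hτ => by
        rw [uIcc_of_le hD.le] at hτ
        simp only [hb0 x hx τ hτ]
    have hbL0sq : Continuous fun τ => b L 0 τ ^ 2 := hbL0.pow 2
    rw [hG, intervalIntegral.integral_add (hGI.intervalIntegrable _ _)
      (hbL0sq.intervalIntegrable _ _), hb0' L hLL,
      intervalIntegral_swap_of_continuous hb0sq hD.le hL.le]
    congr 1
    refine intervalIntegral.integral_congr fun x hx => ?_
    rw [uIcc_of_le hL.le] at hx
    exact hb0' x hx
  set E : ℝ → ℝ := fun τ => (∫ x in (0:ℝ)..L, Real.exp (-μ * x) * z' x τ ^ 2)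
    + M * (∫ x in (0:ℝ)..L, Real.exp (ν * x) * v' x τ ^ 2) + R * v' L τ ^ 2 with hE
  have hweight : ∀ {f : ℝ → ℝ → ℝ} (a : ℝ), Continuous (Function.uncurry f) →
      Continuous fun τ => ∫ x in (0:ℝ)..L, Real.exp (a * x) * f x τ ^ 2 := fun {f} a hf => by
    refine intervalIntegral.continuous_parametric_intervalIntegral_of_continuous'
      (f := fun τ x => Real.exp (a * x) * f x τ ^ 2) ?_ _ _
    exact (by fun_prop : Continuous fun p : ℝ × ℝ => Real.exp (a * p.2)).mul ((hcurry hf).pow 2)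
  have hvLc : Continuous fun τ => v' L τ := hvc.comp (continuous_const.prodMk continuous_id)
  have hEc : Continuous E :=
    ((hweight _ hzc).add ((hweight _ hvc).const_mul M)).add ((hvLc.pow 2).const_mul R)
  have hE' : ∀ t > 0, ∃ E', HasDerivAt E E' t ∧ E' ≤ -θ * E t + K * G t := by
    intro t ht
    have hzd := hasDerivAt_weighted_energy (a := -c1) (μ := -μ)
      (g := fun x => c1 * c2 * z' x t - c3 * Real.exp (c2 * x) * b x 0 t
        - k * c3 / c6 * Real.exp (c2 * x) * v' x t) hL ht hzc hztc hzxc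
      (by have := hzX t; have := hvX t; have := hbx 0 t; fun_prop) hzt
      (fun x hx => hzx x hx t ht.le) fun x hx => by
        have hx' := Ioo_subset_Icc_self hx
        have h := hzpde x hx t ht
        rw [hzdx x hx t ht.le, ← hze x hx' t ht.le, ← hbe x hx' 0 h0D t ht.le,
          ← hve x hx' t ht.le] at h
        linarith [(hzdt x hx' t ht).symm.trans h]
    have hvd := hasDerivAt_weighted_energy (a := c4) (μ := ν)
      (g := fun x => -c6 * b x 0 t - k * v' x t) hL ht hvc hvtc hvxc
      (by have := hvX t; have := hbx 0 t; fun_prop) hvt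
      (fun x hx => hvx x hx t ht.le) fun x hx => by
        have hx' := Ioo_subset_Icc_self hx
        have h := hvpde x hx t ht
        rw [hvdx x hx t ht.le, ← hbe x hx' 0 h0D t ht.le, ← hve x hx' t ht.le] at h
        linarith [(hvdt x hx' t ht).symm.trans h]
    have hvLt : vt L t = -k * v' L t - c6 * b L 0 t := by
      rw [hve L hLL t ht.le, hbe L hLL 0 h0D t ht.le]
      exact (hvdt L hLL t ht).symm.trans (hvL t ht)
    have hqd := (hvt L hLL t ht).pow 2
    refine ⟨_, (hzd.add (hvd.const_mul M)).add (hqd.const_mul R), ?_⟩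
    have hzs := weighted_source_z_le (b := c1 * c2) (c := c3) (d := k * c3 / c6) hL.le hμ.le
      hc2.le (hzX t) (hvX t) (hbx 0 t)
    have hvs := weighted_source_v_le (c := c6) hL.le hν.le hk.le (hvX t) (hbx 0 t)
    have hvn := (integral_exp_mul_sq_bounds hL.le hν.le (hvX t)).1
    have hzbc : z' 0 t ^ 2 = c7 ^ 2 * v' 0 t ^ 2 := by
      rw [hze 0 h0L t ht.le, hve 0 h0L t ht.le, hz0 t ht.le]
      ring
    have hBnn : 0 ≤ ∫ x in (0:ℝ)..L, b x 0 t ^ 2 :=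
      intervalIntegral.integral_nonneg hL.le fun x _ => sq_nonneg _
    have hZnn : 0 ≤ ∫ x in (0:ℝ)..L, Real.exp (-μ * x) * z' x t ^ 2 :=
      intervalIntegral.integral_nonneg hL.le fun x _ => by positivity
    have hVnn : 0 ≤ ∫ x in (0:ℝ)..L, Real.exp (ν * x) * v' x t ^ 2 :=
      intervalIntegral.integral_nonneg hL.le fun x _ => by positivity
    simp only [hE, hG]
    rw [hvLt, hzbc, ← hΛe]
    rw [← hK1e, ← hK2e] at hzs
    rw [← hΛe] at hvs
    have hexpL : 0 ≤ Real.exp (-μ * L) * z' L t ^ 2 := by positivity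
    generalize (∫ x in (0:ℝ)..L, Real.exp (-μ * x) * z' x t ^ 2) = Z at *
    generalize (∫ x in (0:ℝ)..L, Real.exp (ν * x) * v' x t ^ 2) = V at *
    generalize (∫ x in (0:ℝ)..L, b x 0 t ^ 2) = B at *
    generalize (∫ x in (0:ℝ)..L, v' x t ^ 2) = V0 at *
    generalize (∫ x in (0:ℝ)..L, Real.exp (-μ * x) * (2 * z' x t *
        (c1 * c2 * z' x t - c3 * Real.exp (c2 * x) * b x 0 t
          - k * c3 / c6 * Real.exp (c2 * x) * v' x t))) = SZ at *
    generalize (∫ x in (0:ℝ)..L, Real.exp (ν * x) * (2 * v' x t *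
        (-c6 * b x 0 t - k * v' x t))) = SV at *
    generalize Real.exp (-μ * L) * z' L t ^ 2 = zL at *
    have e1 : c1 * μ * Z = (2 * (c1 * c2) + 3) * Z := by rw [hμe]
    have e2 : M * (c4 * ν * V) = M * (2 * V) := by rw [hνe]
    have i1 := mul_le_mul_of_nonneg_left hvs (by linarith : 0 ≤ M)
    have i2 := mul_le_mul_of_nonneg_left hvn hK2
    have i3 := mul_le_mul_of_nonneg_right hMK hVnn
    have i4 := mul_le_mul_of_nonneg_right hMc (sq_nonneg (v' 0 t))
    have i5 := mul_le_mul_of_nonneg_right hRk (sq_nonneg (v' L t))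
    have i6 := mul_le_mul_of_nonneg_right hKL (sq_nonneg (b L 0 t))
    have i7 := mul_le_mul_of_nonneg_right hKB hBnn
    have i8 := mul_le_mul_of_nonneg_right hθ1 hZnn
    have i9 := mul_le_mul_of_nonneg_right hθM hVnn
    have i10 := mul_le_mul_of_nonneg_right hθR (sq_nonneg (v' L t))
    have i11 := mul_nonneg hc1.le hexpL
    have i12 : 0 ≤ R * (k * (v' L t + c6 / k * b L 0 t) ^ 2) := by positivity
    have e3 : R * (k * (v' L t + c6 / k * b L 0 t) ^ 2) =
        R * k * v' L t ^ 2 + 2 * R * c6 * v' L t * b L 0 t + R * (c6 ^ 2 / k) * b L 0 t ^ 2 := by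
      field_simp
      ring
    push_cast
    linarith
  have hdecay := exp_mul_le_of_hasDerivAt_le hEc hGc hθ.le hK hGnn hGD hE' ht.le
  rw [hGint] at hdecay
  have hz1 := (integral_exp_neg_mul_sq_bounds hL.le hμ.le (hzX t)).1
  have hz2 := (integral_exp_neg_mul_sq_bounds hL.le hμ.le (hzX 0)).2
  have hv1 := (integral_exp_mul_sq_bounds hL.le hν.le (hvX t)).1
  have hv2 := (integral_exp_mul_sq_bounds hL.le hν.le (hvX 0)).2
  have hzI : 0 ≤ ∫ x in (0:ℝ)..L, z' x 0 ^ 2 :=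
    intervalIntegral.integral_nonneg hL.le fun x _ => sq_nonneg _
  have hvI : 0 ≤ ∫ x in (0:ℝ)..L, v' x 0 ^ 2 :=
    intervalIntegral.integral_nonneg hL.le fun x _ => sq_nonneg _
  have hvI' : 0 ≤ ∫ x in (0:ℝ)..L, Real.exp (ν * x) * v' x t ^ 2 :=
    intervalIntegral.integral_nonneg hL.le fun x _ => by positivity
  have hβI : 0 ≤ ∫ s in (0:ℝ)..D, b L s 0 ^ 2 :=
    intervalIntegral.integral_nonneg hD.le fun x _ => sq_nonneg _
  have hβII : 0 ≤ ∫ x in (0:ℝ)..L, ∫ s in (0:ℝ)..D, b x s 0 ^ 2 :=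
    intervalIntegral.integral_nonneg hL.le fun x _ =>
      intervalIntegral.integral_nonneg hD.le fun x _ => sq_nonneg _
  have hupper : (∫ x in (0:ℝ)..L, z' x t ^ 2) + (∫ x in (0:ℝ)..L, v' x t ^ 2) + v' L t ^ 2 ≤
      C0 * E t := by
    have h1 : (∫ x in (0:ℝ)..L, Real.exp (ν * x) * v' x t ^ 2) ≤
        C0 * M * ∫ x in (0:ℝ)..L, Real.exp (ν * x) * v' x t ^ 2 :=
      le_mul_of_one_le_left hvI' (one_le_mul_of_one_le_of_one_le hC0' hM)
    have h2 : v' L t ^ 2 ≤ C0 * R * v' L t ^ 2 :=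
      le_mul_of_one_le_left (sq_nonneg _) (one_le_mul_of_one_le_of_one_le hC0' hR)
    simp only [hE]
    linarith
  have hlower : E 0 ≤ (1 + M * Λ + R) *
      ((∫ x in (0:ℝ)..L, z' x 0 ^ 2) + (∫ x in (0:ℝ)..L, v' x 0 ^ 2) + v' L 0 ^ 2) := by
    rw [← hΛe] at hv2
    have h1 := mul_le_mul_of_nonneg_left hv2 (by linarith : 0 ≤ M)
    have h2 : 0 ≤ M * Λ := by positivity
    have hq := sq_nonneg (v' L 0)
    have h3 := mul_nonneg h2 (add_nonneg hzI hq)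
    have h4 := mul_nonneg (by linarith : 0 ≤ R) (add_nonneg hzI hvI)
    simp only [hE]
    linarith
  have hexp : Real.exp (-θ * t) * Real.exp (θ * t) = 1 := by
    rw [← Real.exp_add, neg_mul, neg_add_cancel, Real.exp_zero]
  have hEt : E t ≤ Real.exp (-θ * t) * (E 0 + K * (Real.exp (θ * D) *
      ((∫ x in (0:ℝ)..L, ∫ s in (0:ℝ)..D, b x s 0 ^ 2) + ∫ s in (0:ℝ)..D, b L s 0 ^ 2))) := by
    have h := mul_le_mul_of_nonneg_left hdecay (Real.exp_pos (-θ * t)).le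
    rwa [← mul_assoc, hexp, one_mul] at h
  have hq0 := sq_nonneg (v' L 0)
  set A0 := (∫ x in (0:ℝ)..L, z' x 0 ^ 2) + (∫ x in (0:ℝ)..L, v' x 0 ^ 2) + v' L 0 ^ 2
  set B2 := ∫ x in (0:ℝ)..L, ∫ s in (0:ℝ)..D, b x s 0 ^ 2
  set B1 := ∫ s in (0:ℝ)..D, b L s 0 ^ 2
  have hA0 : 0 ≤ A0 := by positivity
  set ε := Real.exp (-θ * t) with hε
  set Γ := Real.exp (θ * D) with hΓ
  have hε0 : 0 ≤ ε := (Real.exp_pos _).le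
  have hΓ0 : 0 ≤ Γ := (Real.exp_pos _).le
  have hfull : C0 * E t ≤ C0 * (ε * ((1 + M * Λ + R) * A0 + K * (Γ * (B2 + B1)))) := by
    gcongr
    refine hEt.trans ?_
    gcongr
  have r1 : 0 ≤ C0 * (1 + M * Λ + R) * ε * (B2 + B1) := by positivity
  have r2 : 0 ≤ (C0 * K * Γ + Γ) * ε * A0 := by positivity
  linarith
end
end

section
/- Assume the coefficient relations c2·c4 = c5·c7 and c1·c2·c6 = c3·c5. There exist constants α1, α2 > 0, depending only on L, D, c1, …, c7, k, such that for all continuous functions ψ : [0,L]×[0,D]→ℝ, z : [0,L]→ℝ, v : [0,L]→ℝ with z(0) = −c7·v(0), the Lyapunov functionals V1 := ‖z‖² + ‖v‖² + |v(L)|² + ‖ψ‖² + ‖ψ(L,·)‖² and V2 := ‖z‖² + ‖v‖² + |v(L)|² + ‖β‖² + ‖β(L,·)‖², where β is the backstepping transform of (ψ,z,v), satisfy α1·V2 ≤ V1 ≤ α2·V2. -/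
open Set MeasureTheory

noncomputable section

open scoped ENNReal

/-- The measure on `[0, L]` whose `L²` space carries both the function and its trace at `L`. -/
def traceMeasure (L : ℝ) : Measure ℝ := volume.restrict (Icc 0 L) + Measure.dirac L

instance (L : ℝ) : IsFiniteMeasure (traceMeasure L) := by
  unfold traceMeasure; infer_instance

theorem lintegral_traceMeasure (L : ℝ) (f : ℝ → ℝ≥0∞) :
    ∫⁻ x, f x ∂(traceMeasure L) = (∫⁻ x in Icc 0 L, f x) + f L := by
  rw [traceMeasure, lintegral_add_measure, lintegral_dirac]

theorem lintegral_traceMeasure_mono {L : ℝ} (hL : 0 ≤ L) {f g : ℝ → ℝ≥0∞}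
    (h : ∀ x ∈ Icc 0 L, f x ≤ g x) :
    ∫⁻ x, f x ∂(traceMeasure L) ≤ ∫⁻ x, g x ∂(traceMeasure L) := by
  rw [lintegral_traceMeasure, lintegral_traceMeasure]
  exact add_le_add (setLIntegral_mono' measurableSet_Icc h) (h L ⟨hL, le_rfl⟩)

theorem ENNReal.add_sq_le_four_mul (a b : ℝ≥0∞) : (a + b) ^ 2 ≤ 4 * (a ^ 2 + b ^ 2) := by
  rcases le_total a b with h | h
  · calc (a + b) ^ 2 ≤ (b + b) ^ 2 := by gcongr
      _ = 4 * b ^ 2 := by ring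
      _ ≤ _ := by gcongr; exact le_add_self
  · calc (a + b) ^ 2 ≤ (a + a) ^ 2 := by gcongr
      _ = 4 * a ^ 2 := by ring
      _ ≤ _ := by gcongr; exact le_self_add

theorem ENNReal.add_five_sq_le (a b c d e : ℝ≥0∞) :
    (a + b + c + d + e) ^ 2 ≤ 256 * (a ^ 2 + b ^ 2 + c ^ 2 + d ^ 2 + e ^ 2) := by
  have h1 := ENNReal.add_sq_le_four_mul (a + b + c + d) e
  have h2 := ENNReal.add_sq_le_four_mul (a + b + c) d
  have h3 := ENNReal.add_sq_le_four_mul (a + b) c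
  have h4 := ENNReal.add_sq_le_four_mul a b
  calc (a + b + c + d + e) ^ 2
      ≤ 4 * (4 * (4 * (4 * (a ^ 2 + b ^ 2) + c ^ 2) + d ^ 2) + e ^ 2) := by
        refine h1.trans ?_; gcongr; refine h2.trans ?_; gcongr; refine h3.trans ?_; gcongr
    _ = 256 * a ^ 2 + 256 * b ^ 2 + 64 * c ^ 2 + 16 * d ^ 2 + 4 * e ^ 2 := by ring
    _ ≤ 256 * a ^ 2 + 256 * b ^ 2 + 256 * c ^ 2 + 256 * d ^ 2 + 256 * e ^ 2 := by
        gcongr <;> norm_num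
    _ = _ := by ring

theorem lintegral_mul_sq_le {α : Type*} [MeasurableSpace α] (μ : Measure α) {f g : α → ℝ≥0∞}
    (hf : Measurable f) (hg : Measurable g) :
    (∫⁻ x, f x * g x ∂μ) ^ 2 ≤ (∫⁻ x, f x ^ 2 ∂μ) * ∫⁻ x, g x ^ 2 ∂μ := by
  have h := ENNReal.lintegral_mul_le_Lp_mul_Lq μ Real.HolderConjugate.two_two
    hf.aemeasurable hg.aemeasurable
  simp only [Pi.mul_apply, ENNReal.rpow_two] at h
  refine (pow_le_pow_left' h 2).trans_eq ?_
  rw [mul_pow, ← ENNReal.rpow_two, ← ENNReal.rpow_two, ← ENNReal.rpow_mul, ← ENNReal.rpow_mul]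
  norm_num

theorem lintegral_sq_le {α : Type*} [MeasurableSpace α] (μ : Measure α) {f : α → ℝ≥0∞}
    (hf : Measurable f) : (∫⁻ x, f x ∂μ) ^ 2 ≤ μ univ * ∫⁻ x, f x ^ 2 ∂μ := by
  simpa using lintegral_mul_sq_le μ (measurable_const (a := (1 : ℝ≥0∞))) hf

theorem lintegral_comp_affine {f : ℝ → ℝ≥0∞} (hf : Measurable f) {a : ℝ} (ha : a ≠ 0) (c : ℝ) :
    ∫⁻ x, f (a * x + c) = ENNReal.ofReal |a⁻¹| * ∫⁻ x, f x := by
  have h : ∫⁻ x, f (x + c) ∂(Measure.map (a * ·) volume) = ∫⁻ x, f (a * x + c) :=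
    lintegral_map (by fun_prop) (by fun_prop)
  rw [← h, Real.map_volume_mul_left ha, lintegral_smul_measure, smul_eq_mul,
    lintegral_add_right_eq_self]

theorem lintegral_traceMeasure_affine_le {f : ℝ → ℝ≥0∞} (hf : Measurable f) (L D : ℝ) {a b : ℝ}
    (ha : a ≠ 0) (hb : b ≠ 0) :
    ∫⁻ x, (∫⁻ t in Icc 0 D, f (a * x + b * t)) ∂(traceMeasure L) ≤
      (ENNReal.ofReal D * ENNReal.ofReal |a⁻¹| + ENNReal.ofReal |b⁻¹|) * ∫⁻ y, f y := by
  rw [lintegral_traceMeasure, add_mul]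
  refine add_le_add ?_ ?_
  · rw [lintegral_lintegral_swap (by fun_prop)]
    calc _ ≤ ∫⁻ t in Icc 0 D, ENNReal.ofReal |a⁻¹| * ∫⁻ y, f y := by
          refine lintegral_mono fun t => ?_
          rw [← lintegral_comp_affine hf ha]
          exact setLIntegral_le_lintegral _ _
      _ = _ := by
          rw [lintegral_const, Measure.restrict_apply_univ, Real.volume_Icc, sub_zero]; ring
  · refine (setLIntegral_le_lintegral _ _).trans_eq ?_
    rw [← lintegral_comp_affine hf hb (a * L)]
    simp only [add_comm]

/-- Squared norm of `f` on `[0, L] × [0, D]` plus squared norm of its trace at `x = L`. -/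
def sqNorm (L D : ℝ) (f : ℝ × ℝ → ℝ≥0∞) : ℝ≥0∞ :=
  ∫⁻ x, (∫⁻ s in Icc 0 D, f (x, s) ^ 2) ∂(traceMeasure L)

theorem sqNorm_mono {L D : ℝ} (hL : 0 ≤ L) {f g : ℝ × ℝ → ℝ≥0∞}
    (h : ∀ x ∈ Icc 0 L, ∀ s ∈ Icc 0 D, f (x, s) ≤ g (x, s)) : sqNorm L D f ≤ sqNorm L D g :=
  lintegral_traceMeasure_mono hL fun x hx =>
    setLIntegral_mono' measurableSet_Icc fun s hs => pow_le_pow_left' (h x hx s hs) 2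

theorem sqNorm_add_le (L D : ℝ) (f : ℝ × ℝ → ℝ≥0∞) {g : ℝ × ℝ → ℝ≥0∞} (hg : Measurable g) :
    sqNorm L D (fun p => f p + g p) ≤ 4 * (sqNorm L D f + sqNorm L D g) := by
  have hg2 : Measurable fun x => ∫⁻ s in Icc 0 D, g (x, s) ^ 2 :=
    (hg.pow_const 2).lintegral_prod_right'
  unfold sqNorm
  rw [← lintegral_add_right _ hg2, ← lintegral_const_mul' _ _ (by norm_num)]
  refine lintegral_mono fun x => ?_
  rw [← lintegral_add_right _ (by fun_prop), ← lintegral_const_mul' _ _ (by norm_num)]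
  exact lintegral_mono fun s => ENNReal.add_sq_le_four_mul _ _

theorem sqNorm_const_mul (L D : ℝ) {c : ℝ≥0∞} (hc : c ≠ ∞) (f : ℝ × ℝ → ℝ≥0∞) :
    sqNorm L D (fun p => c * f p) = c ^ 2 * sqNorm L D f := by
  unfold sqNorm
  simp only [mul_pow]
  have hc2 : c ^ 2 ≠ ∞ := ENNReal.pow_ne_top hc
  rw [← lintegral_const_mul' _ _ hc2]
  simp only [lintegral_const_mul' _ _ hc2]

/-- Sum of the values of `h` at time `s - τ` that enter the Volterra part of the transform. -/
def delayed (L c1 c4 : ℝ) (h : ℝ × ℝ → ℝ≥0∞) (x s τ : ℝ) : ℝ≥0∞ :=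
  h (x - c1 * τ, s - τ) + h (x + c4 * τ, s - τ) + h (c4 * (τ - x / c1), s - τ) + h (L, s - τ)
    + ∫⁻ y in Icc 0 L, h (y, s - τ)

/-- Majorant of the Volterra part of the backstepping transform. -/
def volterraMajorant (L D c1 c4 : ℝ) (h : ℝ × ℝ → ℝ≥0∞) (p : ℝ × ℝ) : ℝ≥0∞ :=
  ∫⁻ τ in Icc 0 D, delayed L c1 c4 h p.1 p.2 τ

/-- Majorant of the part of the backstepping transform that depends on `z` and `v`. -/
def dataMajorant (L c1 c4 : ℝ) (z v : ℝ → ℝ≥0∞) (p : ℝ × ℝ) : ℝ≥0∞ :=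
  z (p.1 - c1 * p.2) + v (c4 * (p.2 - p.1 / c1)) + v (p.1 + c4 * p.2) + v L
    + ((∫⁻ y in Icc 0 L, z y) + ∫⁻ y in Icc 0 L, v y)

theorem measurable_lintegral_time {h : ℝ × ℝ → ℝ≥0∞} (hh : Measurable h) (L : ℝ) :
    Measurable fun s => ∫⁻ y in Icc 0 L, h (y, s) :=
  hh.lintegral_prod_left'

theorem measurable_delayed {h : ℝ × ℝ → ℝ≥0∞} (hh : Measurable h) (L c1 c4 : ℝ) :
    Measurable fun q : (ℝ × ℝ) × ℝ => delayed L c1 c4 h q.1.1 q.1.2 q.2 := by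
  have := measurable_lintegral_time hh L
  unfold delayed
  fun_prop

theorem measurable_volterraMajorant {h : ℝ × ℝ → ℝ≥0∞} (hh : Measurable h) (L D c1 c4 : ℝ) :
    Measurable (volterraMajorant L D c1 c4 h) :=
  (measurable_delayed hh L c1 c4).lintegral_prod_right'

theorem measurable_dataMajorant {z v : ℝ → ℝ≥0∞} (hz : Measurable z) (hv : Measurable v)
    (L c1 c4 : ℝ) : Measurable (dataMajorant L c1 c4 z v) := by
  unfold dataMajorant
  fun_prop

theorem lintegral_lintegral_time_le {f : ℝ → ℝ≥0∞} (hf : Measurable f) (D : ℝ) :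
    ∫⁻ s in Icc 0 D, ∫⁻ τ in Icc 0 D, f (s - τ) ≤ ENNReal.ofReal D * ∫⁻ s, f s := by
  rw [lintegral_lintegral_swap (by fun_prop)]
  calc _ ≤ ∫⁻ τ in Icc 0 D, ∫⁻ s, f s := by
        refine lintegral_mono fun τ => (setLIntegral_le_lintegral _ _).trans_eq ?_
        exact lintegral_sub_right_eq_self f τ
    _ = _ := by rw [lintegral_const, Measure.restrict_apply_univ, Real.volume_Icc, sub_zero,
                  mul_comm]

theorem lintegral_delay_affine_le {h : ℝ × ℝ → ℝ≥0∞} (hh : Measurable h) (L D : ℝ) {a b : ℝ}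
    (ha : a ≠ 0) (hb : b ≠ 0) :
    ∫⁻ x, (∫⁻ s in Icc 0 D, ∫⁻ τ in Icc 0 D, h (a * x + b * τ, s - τ)) ∂(traceMeasure L) ≤
      (ENNReal.ofReal D * ENNReal.ofReal |a⁻¹| + ENNReal.ofReal |b⁻¹|) * ∫⁻ y, ∫⁻ s, h (y, s) := by
  have hm : Measurable fun y => ∫⁻ s, h (y, s) := hh.lintegral_prod_right'
  refine le_trans (lintegral_mono fun x => ?_) (lintegral_traceMeasure_affine_le hm L D ha hb)
  rw [lintegral_lintegral_swap (by fun_prop)]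
  refine lintegral_mono fun τ => (setLIntegral_le_lintegral _ _).trans_eq ?_
  exact lintegral_sub_right_eq_self (fun s => h (a * x + b * τ, s)) τ

theorem lintegral_eq_of_support {f : ℝ → ℝ≥0∞} {L : ℝ} (hf : ∀ x ∉ Icc 0 L, f x = 0) :
    ∫⁻ x, f x = ∫⁻ x in Icc 0 L, f x := by
  rw [← lintegral_indicator measurableSet_Icc]
  refine lintegral_congr fun x => ?_
  by_cases hx : x ∈ Icc 0 L
  · rw [indicator_of_mem hx]
  · rw [indicator_of_notMem hx, hf x hx]

theorem sqNorm_eq_of_support {L D : ℝ} {h : ℝ × ℝ → ℝ≥0∞}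
    (hx : ∀ x ∉ Icc 0 L, ∀ s, h (x, s) = 0) (hs : ∀ x, ∀ s ∉ Icc 0 D, h (x, s) = 0) :
    sqNorm L D h = (∫⁻ x, ∫⁻ s, h (x, s) ^ 2) + ∫⁻ s, h (L, s) ^ 2 := by
  have h1 (x : ℝ) : ∫⁻ s, h (x, s) ^ 2 = ∫⁻ s in Icc 0 D, h (x, s) ^ 2 :=
    lintegral_eq_of_support fun s h' => by simp [hs x s h']
  rw [sqNorm, lintegral_traceMeasure, h1, lintegral_eq_of_support (L := L)]
  · simp only [h1]
  · intro x h'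
    simp [hx x h']

theorem exists_lintegral_delayed_sq_le (L D : ℝ) {c1 c4 : ℝ} (h1 : c1 ≠ 0) (h4 : c4 ≠ 0) :
    ∃ C : ℝ≥0∞, C ≠ ∞ ∧ ∀ h : ℝ × ℝ → ℝ≥0∞, Measurable h →
      (∀ x ∉ Icc 0 L, ∀ s, h (x, s) = 0) → (∀ x, ∀ s ∉ Icc 0 D, h (x, s) = 0) →
      ∫⁻ x, (∫⁻ s in Icc 0 D, ∫⁻ τ in Icc 0 D, delayed L c1 c4 h x s τ ^ 2) ∂(traceMeasure L) ≤
        C * sqNorm L D h := by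
  set A : ℝ → ℝ → ℝ≥0∞ := fun a b =>
    ENNReal.ofReal D * ENNReal.ofReal |a⁻¹| + ENNReal.ofReal |b⁻¹| with hA
  have hAtop (a b : ℝ) : A a b ≠ ∞ := by
    simp only [hA]; finiteness
  set m := traceMeasure L univ
  have hm : m ≠ ∞ := measure_ne_top _ _
  refine ⟨256 * (A 1 (-c1) + A 1 c4 + A (-(c4 / c1)) c4 + m * ENNReal.ofReal D
    + m * (ENNReal.ofReal L * ENNReal.ofReal D)), ?_, fun h hh hx hs => ?_⟩
  · have := hAtop 1 (-c1); have := hAtop 1 c4; have := hAtop (-(c4 / c1)) c4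
    finiteness
  have hN := sqNorm_eq_of_support hx hs
  set N := ∫⁻ x, ∫⁻ s, h (x, s) ^ 2 with hNdef
  have hNle : N ≤ sqNorm L D h := hN ▸ le_self_add
  have hTle : ∫⁻ s, h (L, s) ^ 2 ≤ sqNorm L D h := hN ▸ le_add_self
  have hh2 : Measurable fun p => h p ^ 2 := hh.pow_const 2
  have e1 := lintegral_delay_affine_le hh2 L D (a := 1) (b := -c1) one_ne_zero (neg_ne_zero.2 h1)
  have e2 := lintegral_delay_affine_le hh2 L D (a := 1) (b := c4) one_ne_zero h4
  have e3 := lintegral_delay_affine_le hh2 L D (a := -(c4 / c1)) (b := c4)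
    (neg_ne_zero.2 (div_ne_zero h4 h1)) h4
  have e4 := lintegral_lintegral_time_le (f := fun s => h (L, s) ^ 2) (by fun_prop) D
  have e5 := lintegral_lintegral_time_le (f := fun s => ∫⁻ y in Icc 0 L, h (y, s) ^ 2)
    (measurable_lintegral_time hh2 L) D
  have e5' : ∫⁻ s in Icc 0 D, ∫⁻ τ in Icc 0 D, (∫⁻ y in Icc 0 L, h (y, s - τ)) ^ 2 ≤
      ENNReal.ofReal L * ENNReal.ofReal D * N := by
    calc _ ≤ ∫⁻ s in Icc 0 D, ∫⁻ τ in Icc 0 D,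
          ENNReal.ofReal L * ∫⁻ y in Icc 0 L, h (y, s - τ) ^ 2 := by
          refine lintegral_mono fun s => lintegral_mono fun τ => ?_
          simpa using lintegral_sq_le (volume.restrict (Icc 0 L))
            (f := fun y => h (y, s - τ)) (by fun_prop)
      _ = ENNReal.ofReal L * ∫⁻ s in Icc 0 D, ∫⁻ τ in Icc 0 D,
          ∫⁻ y in Icc 0 L, h (y, s - τ) ^ 2 := by
          simp only [lintegral_const_mul' _ _ ENNReal.ofReal_ne_top]
      _ ≤ ENNReal.ofReal L * (ENNReal.ofReal D * ∫⁻ s, ∫⁻ y in Icc 0 L, h (y, s) ^ 2) := by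
          gcongr
      _ ≤ ENNReal.ofReal L * (ENNReal.ofReal D * N) := by
          gcongr
          rw [hNdef, lintegral_lintegral_swap (by fun_prop)]
          exact setLIntegral_le_lintegral _ _
      _ = _ := by ring
  have hL := measurable_lintegral_time hh L
  have key (x : ℝ) : ∫⁻ s in Icc 0 D, ∫⁻ τ in Icc 0 D, delayed L c1 c4 h x s τ ^ 2 ≤
      256 * ((∫⁻ s in Icc 0 D, ∫⁻ τ in Icc 0 D, h (1 * x + -c1 * τ, s - τ) ^ 2)
        + (∫⁻ s in Icc 0 D, ∫⁻ τ in Icc 0 D, h (1 * x + c4 * τ, s - τ) ^ 2)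
        + (∫⁻ s in Icc 0 D, ∫⁻ τ in Icc 0 D, h (-(c4 / c1) * x + c4 * τ, s - τ) ^ 2)
        + (∫⁻ s in Icc 0 D, ∫⁻ τ in Icc 0 D, h (L, s - τ) ^ 2)
        + ∫⁻ s in Icc 0 D, ∫⁻ τ in Icc 0 D, (∫⁻ y in Icc 0 L, h (y, s - τ)) ^ 2) := by
    have i (a b : ℝ) : Measurable fun s => ∫⁻ τ in Icc 0 D, h (a * x + b * τ, s - τ) ^ 2 :=
      Measurable.lintegral_prod_right' (f := fun q : ℝ × ℝ => h (a * x + b * q.2, q.1 - q.2) ^ 2)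
        (by fun_prop)
    have i4 : Measurable fun s => ∫⁻ τ in Icc 0 D, h (L, s - τ) ^ 2 :=
      Measurable.lintegral_prod_right' (f := fun q : ℝ × ℝ => h (L, q.1 - q.2) ^ 2) (by fun_prop)
    rw [← lintegral_add_left (by fun_prop), ← lintegral_add_left (by fun_prop),
      ← lintegral_add_left (by fun_prop), ← lintegral_add_left (by fun_prop),
      ← lintegral_const_mul' _ _ (by norm_num)]
    refine lintegral_mono fun s => ?_
    simp only
    rw [← lintegral_add_left (by fun_prop), ← lintegral_add_left (by fun_prop),
      ← lintegral_add_left (by fun_prop), ← lintegral_add_left (by fun_prop),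
      ← lintegral_const_mul' _ _ (by norm_num)]
    refine lintegral_mono fun τ => ?_
    rw [delayed, show x - c1 * τ = 1 * x + -c1 * τ by ring,
      show c4 * (τ - x / c1) = -(c4 / c1) * x + c4 * τ by ring,
      show x + c4 * τ = 1 * x + c4 * τ by ring]
    exact ENNReal.add_five_sq_le _ _ _ _ _
  refine (lintegral_mono key).trans ?_
  rw [lintegral_const_mul' _ _ (by norm_num), lintegral_add_right _ (by fun_prop),
    lintegral_add_right _ (by fun_prop)]
  have j (a b : ℝ) : Measurable fun x =>
      ∫⁻ s in Icc 0 D, ∫⁻ τ in Icc 0 D, h (a * x + b * τ, s - τ) ^ 2 := by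
    have : Measurable fun q : ℝ × ℝ => ∫⁻ τ in Icc 0 D, h (a * q.1 + b * τ, q.2 - τ) ^ 2 :=
      Measurable.lintegral_prod_right'
        (f := fun r : (ℝ × ℝ) × ℝ => h (a * r.1.1 + b * r.2, r.1.2 - r.2) ^ 2) (by fun_prop)
    exact this.lintegral_prod_right'
  rw [lintegral_add_right _ (j _ _), lintegral_add_right _ (j _ _), lintegral_const,
    lintegral_const, mul_assoc]
  gcongr
  calc _ ≤ A 1 (-c1) * N + A 1 c4 * N + A (-(c4 / c1)) c4 * N
        + (ENNReal.ofReal D * ∫⁻ s, h (L, s) ^ 2) * m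
        + ENNReal.ofReal L * ENNReal.ofReal D * N * m := by gcongr
    _ ≤ A 1 (-c1) * sqNorm L D h + A 1 c4 * sqNorm L D h + A (-(c4 / c1)) c4 * sqNorm L D h
        + (ENNReal.ofReal D * sqNorm L D h) * m
        + ENNReal.ofReal L * ENNReal.ofReal D * sqNorm L D h * m := by gcongr
    _ = _ := by ring

theorem exists_sqNorm_dataMajorant_le (L D : ℝ) {c1 c4 : ℝ} (h1 : c1 ≠ 0) (h4 : c4 ≠ 0) :
    ∃ C : ℝ≥0∞, C ≠ ∞ ∧ ∀ z v : ℝ → ℝ≥0∞, Measurable z → Measurable v →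
      sqNorm L D (dataMajorant L c1 c4 z v) ≤
        C * ((∫⁻ y, z y ^ 2) + (∫⁻ y, v y ^ 2) + v L ^ 2) := by
  set A : ℝ → ℝ → ℝ≥0∞ := fun a b =>
    ENNReal.ofReal D * ENNReal.ofReal |a⁻¹| + ENNReal.ofReal |b⁻¹| with hA
  have hAtop (a b : ℝ) : A a b ≠ ∞ := by
    simp only [hA]; finiteness
  set m := traceMeasure L univ
  have hm : m ≠ ∞ := measure_ne_top _ _
  refine ⟨256 * (A 1 (-c1) + A (-(c4 / c1)) c4 + A 1 c4 + m * ENNReal.ofReal D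
    + m * ENNReal.ofReal D * (4 * ENNReal.ofReal L)), ?_, fun z v hz hv => ?_⟩
  · have := hAtop 1 (-c1); have := hAtop 1 c4; have := hAtop (-(c4 / c1)) c4
    finiteness
  set N := (∫⁻ y, z y ^ 2) + (∫⁻ y, v y ^ 2) + v L ^ 2 with hN
  have hzN : ∫⁻ y, z y ^ 2 ≤ N := le_self_add.trans le_self_add
  have hvN : ∫⁻ y, v y ^ 2 ≤ N := le_add_self.trans le_self_add
  have hLN : v L ^ 2 ≤ N := le_add_self
  have hz2 : Measurable fun y => z y ^ 2 := hz.pow_const 2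
  have hv2 : Measurable fun y => v y ^ 2 := hv.pow_const 2
  have e1 := lintegral_traceMeasure_affine_le hz2 L D (a := 1) (b := -c1) one_ne_zero
    (neg_ne_zero.2 h1)
  have e2 := lintegral_traceMeasure_affine_le hv2 L D (a := -(c4 / c1)) (b := c4)
    (neg_ne_zero.2 (div_ne_zero h4 h1)) h4
  have e3 := lintegral_traceMeasure_affine_le hv2 L D (a := 1) (b := c4) one_ne_zero h4
  have e5 : ((∫⁻ y in Icc 0 L, z y) + ∫⁻ y in Icc 0 L, v y) ^ 2 ≤
      4 * ENNReal.ofReal L * N := by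
    have hsq {f : ℝ → ℝ≥0∞} (hf : Measurable f) :
        (∫⁻ y in Icc 0 L, f y) ^ 2 ≤ ENNReal.ofReal L * ∫⁻ y, f y ^ 2 := by
      refine (lintegral_sq_le (volume.restrict (Icc 0 L)) hf).trans ?_
      rw [Measure.restrict_apply_univ, Real.volume_Icc, sub_zero]
      gcongr
      exact Measure.restrict_le_self
    refine (ENNReal.add_sq_le_four_mul _ _).trans ?_
    calc _ ≤ 4 * (ENNReal.ofReal L * (∫⁻ y, z y ^ 2) + ENNReal.ofReal L * ∫⁻ y, v y ^ 2) := by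
          gcongr <;> exact hsq (by assumption)
      _ = 4 * ENNReal.ofReal L * ((∫⁻ y, z y ^ 2) + ∫⁻ y, v y ^ 2) := by ring
      _ ≤ _ := by gcongr; exact le_self_add
  set I := ((∫⁻ y in Icc 0 L, z y) + ∫⁻ y in Icc 0 L, v y)
  have key (x : ℝ) : ∫⁻ s in Icc 0 D, dataMajorant L c1 c4 z v (x, s) ^ 2 ≤
      256 * ((∫⁻ s in Icc 0 D, z (1 * x + -c1 * s) ^ 2)
        + (∫⁻ s in Icc 0 D, v (-(c4 / c1) * x + c4 * s) ^ 2)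
        + (∫⁻ s in Icc 0 D, v (1 * x + c4 * s) ^ 2)
        + (∫⁻ s in Icc 0 D, v L ^ 2) + ∫⁻ s in Icc 0 D, I ^ 2) := by
    rw [← lintegral_add_left (by fun_prop), ← lintegral_add_left (by fun_prop),
      ← lintegral_add_left (by fun_prop), ← lintegral_add_left (by fun_prop),
      ← lintegral_const_mul' _ _ (by norm_num)]
    refine lintegral_mono fun s => ?_
    rw [dataMajorant]
    dsimp only
    rw [show x - c1 * s = 1 * x + -c1 * s by ring,
      show c4 * (s - x / c1) = -(c4 / c1) * x + c4 * s by ring,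
      show x + c4 * s = 1 * x + c4 * s by ring]
    exact ENNReal.add_five_sq_le _ _ _ _ _
  refine (lintegral_mono key).trans ?_
  have j {f : ℝ → ℝ≥0∞} (hf : Measurable f) (a b : ℝ) : Measurable fun x =>
      ∫⁻ s in Icc 0 D, f (a * x + b * s) ^ 2 :=
    Measurable.lintegral_prod_right' (f := fun r : ℝ × ℝ => f (a * r.1 + b * r.2) ^ 2)
      (by fun_prop)
  rw [lintegral_const_mul' _ _ (by norm_num), lintegral_add_right _ (by fun_prop),
    lintegral_add_right _ (by fun_prop), lintegral_add_right _ (j hv _ _),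
    lintegral_add_right _ (j hv _ _), lintegral_const,
    lintegral_const, lintegral_const, lintegral_const, Measure.restrict_apply_univ,
    Real.volume_Icc, sub_zero, mul_assoc (256 : ℝ≥0∞)]
  gcongr
  calc _ ≤ A 1 (-c1) * N + A (-(c4 / c1)) c4 * N + A 1 c4 * N
        + N * ENNReal.ofReal D * m + 4 * ENNReal.ofReal L * N * ENNReal.ofReal D * m := by
        gcongr
        · exact e1.trans (by gcongr)
        · exact e2.trans (by gcongr)
        · exact e3.trans (by gcongr)
    _ = _ := by ring

/-- The exponential weight `exp (-r * s)`. -/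
def expWeight (r s : ℝ) : ℝ≥0∞ := ENNReal.ofReal (Real.exp (-(r * s)))

@[fun_prop]
theorem measurable_expWeight (r : ℝ) : Measurable (expWeight r) := by
  unfold expWeight
  fun_prop

theorem expWeight_ne_top (r s : ℝ) : expWeight r s ≠ ∞ := ENNReal.ofReal_ne_top

theorem expWeight_add (r s t : ℝ) : expWeight r (s + t) = expWeight r s * expWeight r t := by
  rw [expWeight, expWeight, expWeight, ← ENNReal.ofReal_mul (Real.exp_nonneg _), ← Real.exp_add]
  ring_nf

theorem expWeight_le_one {r s : ℝ} (hr : 0 ≤ r) (hs : 0 ≤ s) : expWeight r s ≤ 1 := by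
  rw [expWeight, ENNReal.ofReal_le_one, Real.exp_le_one_iff]
  nlinarith

theorem exists_lintegral_expWeight_sq_le (D : ℝ) {δ : ℝ} (hδ : 0 < δ) :
    ∃ r : ℝ, 0 < r ∧ ∫⁻ τ in Icc 0 D, expWeight r τ ^ 2 ≤ ENNReal.ofReal δ := by
  refine ⟨1 / (2 * δ), by positivity, ?_⟩
  have ha : -(1 / δ) < 0 := by
    rw [neg_lt_zero]; positivity
  have hexp (τ : ℝ) :
      expWeight (1 / (2 * δ)) τ ^ 2 = ENNReal.ofReal (Real.exp (-(1 / δ) * τ)) := by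
    rw [expWeight, ← ENNReal.ofReal_pow (Real.exp_nonneg _), ← Real.exp_nat_mul]
    congr 2
    push_cast
    field_simp
  simp only [hexp]
  calc _ ≤ ∫⁻ τ in Ici 0, ENNReal.ofReal (Real.exp (-(1 / δ) * τ)) :=
        lintegral_mono_set Icc_subset_Ici_self
    _ = ∫⁻ τ in Ioi 0, ENNReal.ofReal (Real.exp (-(1 / δ) * τ)) :=
        setLIntegral_congr Ioi_ae_eq_Ici.symm
    _ = ENNReal.ofReal (∫ τ in Ioi 0, Real.exp (-(1 / δ) * τ)) :=
        (ofReal_integral_eq_lintegral_ofReal (integrableOn_exp_mul_Ioi ha 0)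
          (ae_of_all _ fun _ => Real.exp_nonneg _)).symm
    _ ≤ _ := by
        rw [integral_exp_mul_Ioi ha]
        simp

theorem sqNorm_lintegral_mul_le (L D : ℝ) {e : ℝ → ℝ≥0∞} (he : Measurable e)
    {F : (ℝ × ℝ) × ℝ → ℝ≥0∞} (hF : Measurable F) :
    sqNorm L D (fun p => ∫⁻ τ in Icc 0 D, e τ * F (p, τ)) ≤
      (∫⁻ τ in Icc 0 D, e τ ^ 2) *
        ∫⁻ x, (∫⁻ s in Icc 0 D, ∫⁻ τ in Icc 0 D, F ((x, s), τ) ^ 2) ∂(traceMeasure L) := by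
  have hF2 : Measurable fun p : ℝ × ℝ => ∫⁻ τ in Icc 0 D, F (p, τ) ^ 2 :=
    (hF.pow_const 2).lintegral_prod_right'
  have hF3 : Measurable fun x => ∫⁻ s in Icc 0 D, ∫⁻ τ in Icc 0 D, F ((x, s), τ) ^ 2 :=
    hF2.lintegral_prod_right'
  unfold sqNorm
  rw [← lintegral_const_mul _ hF3]
  refine lintegral_mono fun x => ?_
  have hx : Measurable fun s => ∫⁻ τ in Icc 0 D, F ((x, s), τ) ^ 2 :=
    hF2.comp (measurable_const.prodMk measurable_id)
  simp only
  rw [← lintegral_const_mul _ hx]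
  exact lintegral_mono fun s => lintegral_mul_sq_le _ he
    (hF.comp (measurable_const.prodMk measurable_id))

theorem expWeight_mul_volterraMajorant (L D c1 c4 r : ℝ) (h : ℝ × ℝ → ℝ≥0∞) (p : ℝ × ℝ) :
    expWeight r p.2 * volterraMajorant L D c1 c4 h p = ∫⁻ τ in Icc 0 D,
      expWeight r τ * delayed L c1 c4 (fun p => expWeight r p.2 * h p) p.1 p.2 τ := by
  rw [volterraMajorant, ← lintegral_const_mul' _ _ (expWeight_ne_top r p.2)]
  refine lintegral_congr fun τ => ?_
  rw [delayed, delayed, lintegral_const_mul' _ _ (expWeight_ne_top _ _),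
    show expWeight r p.2 = expWeight r τ * expWeight r (p.2 - τ) by
      rw [← expWeight_add, add_sub_cancel]]
  ring

theorem ENNReal.le_two_mul_of_le_add_half {a b : ℝ≥0∞} (ha : a ≠ ∞) (h : a ≤ b + a / 2) :
    a ≤ 2 * b := by
  by_cases hb : b = ∞
  · simp [hb]
  lift a to NNReal using ha
  lift b to NNReal using hb
  rw [show (2 : ℝ≥0∞) = ((2 : NNReal) : ℝ≥0∞) by norm_num, ← ENNReal.coe_div two_ne_zero] at *
  norm_cast at h ⊢
  rw [← NNReal.coe_le_coe] at *
  push_cast at *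
  linarith

/-- Two fields on `[0, L] × [0, D]` that differ by at most a multiple of the Volterra majorant of
one of them plus the data majorant have equivalent norms up to the norm of the data. -/
theorem exists_sqNorm_equiv {L D c1 c4 : ℝ} (hL : 0 ≤ L) (h1 : c1 ≠ 0) (h4 : c4 ≠ 0)
    {K : ℝ≥0∞} (hK : K ≠ ∞) :
    ∃ A : ℝ≥0∞, A ≠ ∞ ∧ ∀ (h b : ℝ × ℝ → ℝ≥0∞) (z v : ℝ → ℝ≥0∞),
      Measurable h → Measurable z → Measurable v →
      (∀ x ∉ Icc 0 L, ∀ s, h (x, s) = 0) → (∀ x, ∀ s ∉ Icc 0 D, h (x, s) = 0) →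
      sqNorm L D h ≠ ∞ →
      (∀ x ∈ Icc 0 L, ∀ s ∈ Icc 0 D, b (x, s) ≤
        h (x, s) + K * (volterraMajorant L D c1 c4 h (x, s) + dataMajorant L c1 c4 z v (x, s))) →
      (∀ x ∈ Icc 0 L, ∀ s ∈ Icc 0 D, h (x, s) ≤
        b (x, s) + K * (volterraMajorant L D c1 c4 h (x, s) + dataMajorant L c1 c4 z v (x, s))) →
      sqNorm L D b ≤
        A * (sqNorm L D h + ((∫⁻ y, z y ^ 2) + (∫⁻ y, v y ^ 2) + v L ^ 2)) ∧
      sqNorm L D h ≤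
        A * (sqNorm L D b + ((∫⁻ y, z y ^ 2) + (∫⁻ y, v y ^ 2) + v L ^ 2)) := by
  obtain ⟨C, hC, hdel⟩ := exists_lintegral_delayed_sq_le L D h1 h4
  obtain ⟨C', hC', hdata⟩ := exists_sqNorm_dataMajorant_le L D h1 h4
  set B : ℝ≥0∞ := 16 * K ^ 2 * C with hB
  have hBtop : B ≠ ∞ := by finiteness
  obtain ⟨r, hr, hε⟩ := exists_lintegral_expWeight_sq_le D
    (δ := 1 / (2 * (B.toReal + 1))) (by positivity)
  set ε := ∫⁻ τ in Icc 0 D, expWeight r τ ^ 2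
  have hBε : B * ε ≤ 1 / 2 := by
    calc B * ε ≤ ENNReal.ofReal B.toReal * ENNReal.ofReal (1 / (2 * (B.toReal + 1))) := by
          rw [ENNReal.ofReal_toReal hBtop]; gcongr
      _ = ENNReal.ofReal (B.toReal * (1 / (2 * (B.toReal + 1)))) :=
          (ENNReal.ofReal_mul ENNReal.toReal_nonneg).symm
      _ ≤ ENNReal.ofReal (1 / 2) := by
          refine ENNReal.ofReal_le_ofReal ?_
          have := @ENNReal.toReal_nonneg B
          rw [mul_one_div, div_le_div_iff₀ (by positivity) (by positivity)]
          linarith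
      _ = 1 / 2 := by rw [ENNReal.ofReal_div_of_pos two_pos]; simp
  set G : ℝ≥0∞ := ENNReal.ofReal (Real.exp (r * D)) ^ 2
  set F : ℝ≥0∞ := 16 * K ^ 2 * C'
  refine ⟨G * (2 * (5 + F)), by finiteness, fun h b z v hh hz hv hx hs hfin hbh hhb => ?_⟩
  set N := (∫⁻ y, z y ^ 2) + (∫⁻ y, v y ^ 2) + v L ^ 2
  have hN := hdata z v hz hv
  have hw : Measurable fun p : ℝ × ℝ => expWeight r p.2 * h p := by fun_prop
  have hV := measurable_volterraMajorant hh L D c1 c4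
  have hM := measurable_dataMajorant hz hv L c1 c4
  have hVol : sqNorm L D (fun p => expWeight r p.2 * volterraMajorant L D c1 c4 h p) ≤
      ε * (C * sqNorm L D fun p => expWeight r p.2 * h p) := by
    simp only [expWeight_mul_volterraMajorant]
    refine (sqNorm_lintegral_mul_le L D (measurable_expWeight r)
      (measurable_delayed hw L c1 c4)).trans ?_
    gcongr
    exact hdel _ hw (fun x hx' s => by simp [hx x hx' s]) (fun x s hs' => by simp [hs x s hs'])
  have compare {f g : ℝ × ℝ → ℝ≥0∞} (hfg : ∀ x ∈ Icc 0 L, ∀ s ∈ Icc 0 D, f (x, s) ≤ g (x, s)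
      + K * (volterraMajorant L D c1 c4 h (x, s) + dataMajorant L c1 c4 z v (x, s))) :
      sqNorm L D (fun p => expWeight r p.2 * f p) ≤
        4 * sqNorm L D (fun p => expWeight r p.2 * g p) + F * N
          + (sqNorm L D fun p => expWeight r p.2 * h p) / 2 := by
    calc _ ≤ sqNorm L D (fun p => expWeight r p.2 * g p + K *
          (expWeight r p.2 * volterraMajorant L D c1 c4 h p + dataMajorant L c1 c4 z v p)) := by
          refine sqNorm_mono hL fun x hx s hs => ?_
          calc _ ≤ expWeight r s * (g (x, s) + K * (volterraMajorant L D c1 c4 h (x, s)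
                + dataMajorant L c1 c4 z v (x, s))) := by gcongr; exact hfg x hx s hs
            _ = expWeight r s * g (x, s) + K * (expWeight r s * volterraMajorant L D c1 c4 h (x, s)
                + expWeight r s * dataMajorant L c1 c4 z v (x, s)) := by ring
            _ ≤ _ := by
                gcongr
                exact mul_le_of_le_one_left' (expWeight_le_one hr.le hs.1)
      _ ≤ 4 * (sqNorm L D (fun p => expWeight r p.2 * g p) + K ^ 2 * (4 *
          (ε * (C * sqNorm L D fun p => expWeight r p.2 * h p) + C' * N))) := by
          refine (sqNorm_add_le _ _ _ (by fun_prop)).trans ?_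
          rw [sqNorm_const_mul _ _ hK]
          gcongr
          refine (sqNorm_add_le _ _ _ hM).trans ?_
          gcongr
      _ = 4 * sqNorm L D (fun p => expWeight r p.2 * g p) + F * N
          + B * ε * sqNorm L D (fun p => expWeight r p.2 * h p) := by ring
      _ ≤ _ := by
          rw [ENNReal.div_eq_inv_mul, ← one_div]
          gcongr
  have weight_le (f : ℝ × ℝ → ℝ≥0∞) :
      sqNorm L D (fun p => expWeight r p.2 * f p) ≤ sqNorm L D f :=
    sqNorm_mono hL fun x _ s hs => mul_le_of_le_one_left' (expWeight_le_one hr.le hs.1)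
  have le_weight (f : ℝ × ℝ → ℝ≥0∞) :
      sqNorm L D f ≤ G * sqNorm L D (fun p => expWeight r p.2 * f p) := by
    rw [← sqNorm_const_mul _ _ ENNReal.ofReal_ne_top]
    refine sqNorm_mono hL fun x _ s hs => ?_
    rw [← mul_assoc, expWeight, ← ENNReal.ofReal_mul (Real.exp_nonneg _), ← Real.exp_add]
    refine le_mul_of_one_le_left' ?_
    rw [ENNReal.one_le_ofReal, Real.one_le_exp_iff]
    nlinarith [hs.2]
  constructor
  · refine (le_weight b).trans ?_
    rw [mul_assoc]
    gcongr
    refine (compare hbh).trans ?_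
    calc _ ≤ 4 * sqNorm L D h + F * N + sqNorm L D h := by
          gcongr
          · exact weight_le h
          · exact ENNReal.half_le_self.trans (weight_le h)
      _ = 5 * sqNorm L D h + F * N := by ring
      _ ≤ 5 * sqNorm L D h + F * N + (5 * sqNorm L D h + 10 * N + F * N
          + 2 * F * sqNorm L D h) := le_self_add
      _ = _ := by ring
  · refine (le_weight h).trans ?_
    rw [mul_assoc]
    gcongr
    refine (ENNReal.le_two_mul_of_le_add_half ?_ (compare hhb)).trans ?_
    · exact ne_top_of_le_ne_top hfin (weight_le h)
    · rw [mul_assoc 2]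
      gcongr
      calc _ ≤ 4 * sqNorm L D b + F * N := by gcongr; exact weight_le b
        _ ≤ 4 * sqNorm L D b + F * N + (sqNorm L D b + F * sqNorm L D b + 5 * N) := le_self_add
        _ = _ := by ring

/-- The real numbers `a` and `b` coincide and are bounded by `g` in absolute value. -/
def EqBounded (a b : ℝ) (g : ℝ≥0∞) : Prop := a = b ∧ ‖a‖ₑ ≤ g

namespace EqBounded

theorem mono {a b : ℝ} {g g' : ℝ≥0∞} (h : EqBounded a b g) (hg : g ≤ g') : EqBounded a b g' :=
  ⟨h.1, h.2.trans hg⟩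

theorem add {a b a' b' : ℝ} {g g' : ℝ≥0∞} (h : EqBounded a b g) (h' : EqBounded a' b' g') :
    EqBounded (a + a') (b + b') (g + g') :=
  ⟨by rw [h.1, h'.1], (enorm_add_le _ _).trans (add_le_add h.2 h'.2)⟩

theorem sub {a b a' b' : ℝ} {g g' : ℝ≥0∞} (h : EqBounded a b g) (h' : EqBounded a' b' g') :
    EqBounded (a - a') (b - b') (g + g') :=
  ⟨by rw [h.1, h'.1], enorm_sub_le.trans (add_le_add h.2 h'.2)⟩

theorem neg {a b : ℝ} {g : ℝ≥0∞} (h : EqBounded a b g) : EqBounded (-a) (-b) g :=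
  ⟨by rw [h.1], by rw [enorm_neg]; exact h.2⟩

theorem const_mul {a b c K : ℝ} {g : ℝ≥0∞} (h : EqBounded a b g) (hc : |c| ≤ K) :
    EqBounded (c * a) (c * b) (ENNReal.ofReal K * g) := by
  refine ⟨by rw [h.1], ?_⟩
  rw [enorm_mul, Real.enorm_eq_ofReal_abs]
  gcongr
  exact h.2

theorem integral {a b D : ℝ} {F F' : ℝ → ℝ} {c : ℝ≥0∞} {g : ℝ → ℝ≥0∞} (hc : c ≠ ∞) (hab : a ≤ b)
    (h : ∀ τ ∈ Icc a b, τ ∈ Icc 0 D ∧ EqBounded (F τ) (F' τ) (c * g τ)) :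
    EqBounded (∫ τ in a..b, F τ) (∫ τ in a..b, F' τ) (c * ∫⁻ τ in Icc 0 D, g τ) := by
  constructor
  · refine intervalIntegral.integral_congr fun τ hτ => (h τ ?_).2.1
    rwa [uIcc_of_le hab] at hτ
  · rw [intervalIntegral.integral_of_le hab, ← lintegral_const_mul' _ _ hc]
    calc _ ≤ ∫⁻ τ in Ioc a b, ‖F τ‖ₑ := enorm_integral_le_lintegral_enorm _
      _ ≤ ∫⁻ τ in Ioc a b, c * g τ :=
          setLIntegral_mono' measurableSet_Ioc fun τ hτ => (h τ (Ioc_subset_Icc_self hτ)).2.2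
      _ ≤ _ := lintegral_mono_set fun τ hτ => (h τ (Ioc_subset_Icc_self hτ)).1

end EqBounded

section Delayed

variable (L c1 c4 : ℝ) (h : ℝ × ℝ → ℝ≥0∞) (x s τ : ℝ)

theorem le_delayed_left : h (x - c1 * τ, s - τ) ≤ delayed L c1 c4 h x s τ :=
  le_self_add.trans <| le_self_add.trans <| le_self_add.trans le_self_add

theorem le_delayed_right : h (x + c4 * τ, s - τ) ≤ delayed L c1 c4 h x s τ :=
  le_add_self.trans <| le_self_add.trans <| le_self_add.trans le_self_add

theorem le_delayed_reflected : h (c4 * (τ - x / c1), s - τ) ≤ delayed L c1 c4 h x s τ :=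
  le_add_self.trans <| le_self_add.trans le_self_add

theorem le_delayed_trace : h (L, s - τ) ≤ delayed L c1 c4 h x s τ :=
  le_add_self.trans le_self_add

theorem le_delayed_integral : ∫⁻ y in Icc 0 L, h (y, s - τ) ≤ delayed L c1 c4 h x s τ :=
  le_add_self

end Delayed

section Data

variable (L c1 c4 : ℝ) (z v : ℝ → ℝ≥0∞) (x s : ℝ)

theorem le_dataMajorant_left : z (x - c1 * s) ≤ dataMajorant L c1 c4 z v (x, s) :=
  le_self_add.trans <| le_self_add.trans <| le_self_add.trans le_self_add

theorem le_dataMajorant_reflected : v (c4 * (s - x / c1)) ≤ dataMajorant L c1 c4 z v (x, s) :=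
  le_add_self.trans <| le_self_add.trans <| le_self_add.trans le_self_add

theorem le_dataMajorant_right : v (x + c4 * s) ≤ dataMajorant L c1 c4 z v (x, s) :=
  le_add_self.trans <| le_self_add.trans le_self_add

theorem le_dataMajorant_trace : v L ≤ dataMajorant L c1 c4 z v (x, s) :=
  le_add_self.trans le_self_add

theorem le_dataMajorant_integral_z :
    ∫⁻ y in Icc 0 L, z y ≤ dataMajorant L c1 c4 z v (x, s) :=
  le_self_add.trans le_add_self

theorem le_dataMajorant_integral_v :
    ∫⁻ y in Icc 0 L, v y ≤ dataMajorant L c1 c4 z v (x, s) :=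
  le_add_self.trans le_add_self

end Data

theorem abs_mul_exp_le {C K E : ℝ} (hC : |C| ≤ K) (hE : E ≤ 0) : |C * Real.exp E| ≤ K := by
  rw [abs_mul, Real.abs_exp]
  exact (mul_le_of_le_one_right (abs_nonneg _) (Real.exp_le_one_iff.2 hE)).trans hC

namespace Params

/-- A common bound for the coefficients of the backstepping transform. -/
def coeffBound (P : Params) : ℝ :=
  P.c1 * P.c2 + P.c5 * P.c7 + P.k + P.k * P.c1 * P.c2 / (P.c1 + P.c4) + P.k * P.c2
    + P.c5 / P.c6 + P.k * P.c5 / (P.c6 * (P.c1 + P.c4)) + P.k * P.c5 / (P.c1 * P.c6)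
    + P.c5 * (P.k + P.c5 * P.c7) / (P.c6 * (P.c1 + P.c4)) + P.c5 * P.c7 / P.c6 + P.k / P.c6
    + P.c1 * P.c5 * P.c7 * (P.k + P.c5 * P.c7) / (P.c4 * P.c6 * (P.c1 + P.c4))

theorem abs_coeff_le (P : Params) (hP : P.Pos) :
    |P.c1 * P.c2| ≤ P.coeffBound ∧ |P.c5 * P.c7| ≤ P.coeffBound ∧ |P.k| ≤ P.coeffBound ∧
    |P.k * P.c1 * P.c2 / (P.c1 + P.c4)| ≤ P.coeffBound ∧ |P.k * P.c2| ≤ P.coeffBound ∧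
    |P.c5 / P.c6| ≤ P.coeffBound ∧ |P.k * P.c5 / (P.c6 * (P.c1 + P.c4))| ≤ P.coeffBound ∧
    |P.k * P.c5 / (P.c1 * P.c6)| ≤ P.coeffBound ∧
    |P.c5 * (P.k + P.c5 * P.c7) / (P.c6 * (P.c1 + P.c4))| ≤ P.coeffBound ∧
    |P.c5 * P.c7 / P.c6| ≤ P.coeffBound ∧ |P.k / P.c6| ≤ P.coeffBound ∧
    |P.c1 * P.c5 * P.c7 * (P.k + P.c5 * P.c7) / (P.c4 * P.c6 * (P.c1 + P.c4))|
      ≤ P.coeffBound := by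
  obtain ⟨-, -, h1, h2, -, h4, h5, h6, h7, hk, -⟩ := hP
  have p1 : 0 < P.c1 * P.c2 := by positivity
  have p2 : 0 < P.c5 * P.c7 := by positivity
  have p4 : 0 < P.k * P.c1 * P.c2 / (P.c1 + P.c4) := by positivity
  have p5 : 0 < P.k * P.c2 := by positivity
  have p6 : 0 < P.c5 / P.c6 := by positivity
  have p7 : 0 < P.k * P.c5 / (P.c6 * (P.c1 + P.c4)) := by positivity
  have p8 : 0 < P.k * P.c5 / (P.c1 * P.c6) := by positivity
  have p9 : 0 < P.c5 * (P.k + P.c5 * P.c7) / (P.c6 * (P.c1 + P.c4)) := by positivity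
  have p10 : 0 < P.c5 * P.c7 / P.c6 := by positivity
  have p11 : 0 < P.k / P.c6 := by positivity
  have p12 : 0 < P.c1 * P.c5 * P.c7 * (P.k + P.c5 * P.c7) / (P.c4 * P.c6 * (P.c1 + P.c4)) := by
    positivity
  unfold coeffBound
  refine ⟨?_, ?_, ?_, ?_, ?_, ?_, ?_, ?_, ?_, ?_, ?_, ?_⟩ <;>
    rw [abs_of_pos (by assumption)] <;> linarith

theorem abs_gk_le (P : Params) (hP : P.Pos) {x y τ : ℝ} (hy : y ≤ x + P.c4 * τ) :
    |P.gk x y τ| ≤ P.coeffBound := by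
  refine abs_mul_exp_le (P.abs_coeff_le hP).2.2.2.1 ?_
  obtain ⟨-, -, h1, h2, -, h4, h5, h6, h7, hk, -⟩ := hP
  have : 0 < P.c1 * P.c2 / (P.c1 + P.c4) := by positivity
  nlinarith

theorem abs_kk_le (P : Params) (hP : P.Pos) {x s y : ℝ} (hx : 0 ≤ x) (hs : 0 ≤ s) (hy : 0 ≤ y) :
    |P.kk x s y| ≤ P.coeffBound := by
  refine abs_mul_exp_le (P.abs_coeff_le hP).2.2.2.2.2.2.1 ?_
  obtain ⟨-, -, h1, h2, -, h4, h5, h6, h7, hk, -⟩ := hP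
  have a : 0 ≤ P.c1 * P.c2 / (P.c1 + P.c4) * x := by positivity
  have b : 0 ≤ P.c2 * P.c4 / (P.c1 + P.c4) * (y + P.c1 * s) := by positivity
  linarith

theorem cc_eq (P : Params) (h4 : P.c4 ≠ 0) (x τ : ℝ) :
    P.cc x τ = P.L - P.c1 * (τ - (P.L - x) / P.c4) := by
  unfold cc
  field_simp
  ring

section Bounds

variable {P : Params} {ψ ψ' : ℝ → ℝ → ℝ} {h : ℝ × ℝ → ℝ≥0∞} {x s : ℝ}

theorem eqBounded_integral_left (hP : P.Pos)
    (H : ∀ x ∈ Icc 0 P.L, ∀ s ∈ Icc 0 P.D, EqBounded (ψ x s) (ψ' x s) (h (x, s)))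
    (hx : x ≤ P.L) (hs : s ≤ P.D) {b : ℝ} (hb : 0 ≤ b) (hbs : b ≤ s) (hbx : P.c1 * b ≤ x) :
    EqBounded
      (∫ τ in (0:ℝ)..b,
        P.c1 * P.c2 * Real.exp (-(P.c1 * P.c2 * τ)) * ψ (x - P.c1 * τ) (s - τ))
      (∫ τ in (0:ℝ)..b,
        P.c1 * P.c2 * Real.exp (-(P.c1 * P.c2 * τ)) * ψ' (x - P.c1 * τ) (s - τ))
      (ENNReal.ofReal P.coeffBound * volterraMajorant P.L P.D P.c1 P.c4 h (x, s)) := by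
  have k1 := (P.abs_coeff_le hP).1
  obtain ⟨-, -, h1, h2, -⟩ := hP
  refine EqBounded.integral ENNReal.ofReal_ne_top hb fun τ hτ => ?_
  have a := mul_le_mul_of_nonneg_left hτ.2 h1.le
  have b := mul_nonneg h1.le hτ.1
  refine ⟨⟨hτ.1, by linarith [hτ.2]⟩, ((H _ ⟨by linarith, by linarith⟩ _
    ⟨by linarith [hτ.2], by linarith [hτ.1]⟩).const_mul (abs_mul_exp_le k1 ?_)).mono ?_⟩
  · nlinarith [mul_nonneg b h2.le]
  · gcongr; exact le_delayed_left ..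

theorem eqBounded_integral_right (hP : P.Pos)
    (H : ∀ x ∈ Icc 0 P.L, ∀ s ∈ Icc 0 P.D, EqBounded (ψ x s) (ψ' x s) (h (x, s)))
    (hx : 0 ≤ x) (hs : s ≤ P.D) {b : ℝ} (hb : 0 ≤ b) (hbs : b ≤ s) (hbx : x + P.c4 * b ≤ P.L) :
    EqBounded
      (∫ τ in (0:ℝ)..b, P.k * ψ (x + P.c4 * τ) (s - τ))
      (∫ τ in (0:ℝ)..b, P.k * ψ' (x + P.c4 * τ) (s - τ))
      (ENNReal.ofReal P.coeffBound * volterraMajorant P.L P.D P.c1 P.c4 h (x, s)) := by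
  have k3 := (P.abs_coeff_le hP).2.2.1
  obtain ⟨-, -, -, -, -, h4, -⟩ := hP
  refine EqBounded.integral ENNReal.ofReal_ne_top hb fun τ hτ => ?_
  have a := mul_le_mul_of_nonneg_left hτ.2 h4.le
  have b := mul_nonneg h4.le hτ.1
  refine ⟨⟨hτ.1, by linarith [hτ.2]⟩, ((H _ ⟨by linarith, by linarith⟩ _
    ⟨by linarith [hτ.2], by linarith [hτ.1]⟩).const_mul k3).mono ?_⟩
  gcongr; exact le_delayed_right ..

theorem eqBounded_integral_integral
    (H : ∀ x ∈ Icc 0 P.L, ∀ s ∈ Icc 0 P.D, EqBounded (ψ x s) (ψ' x s) (h (x, s)))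
    (hs : s ≤ P.D) {a : ℝ} (ha : 0 ≤ a) (has : a ≤ s) {lo hi : ℝ → ℝ} {κ : ℝ → ℝ → ℝ}
    (hτ : ∀ τ ∈ Icc a s, 0 ≤ lo τ ∧ lo τ ≤ hi τ ∧ hi τ ≤ P.L ∧
      ∀ y ∈ Icc (lo τ) (hi τ), |κ y τ| ≤ P.coeffBound) :
    EqBounded
      (∫ τ in a..s, ∫ y in (lo τ)..(hi τ), κ y τ * ψ y (s - τ))
      (∫ τ in a..s, ∫ y in (lo τ)..(hi τ), κ y τ * ψ' y (s - τ))
      (ENNReal.ofReal P.coeffBound * volterraMajorant P.L P.D P.c1 P.c4 h (x, s)) := by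
  refine EqBounded.integral ENNReal.ofReal_ne_top has fun τ hm => ?_
  obtain ⟨hlo, hlh, hhi, hκ⟩ := hτ τ hm
  refine ⟨⟨ha.trans hm.1, hm.2.trans hs⟩,
    (EqBounded.integral (D := P.L) (g := fun y => h (y, s - τ)) ENNReal.ofReal_ne_top hlh
      fun y hy => ?_).mono (by gcongr; exact le_delayed_integral ..)⟩
  have hy' : y ∈ Icc 0 P.L := ⟨hlo.trans hy.1, hy.2.trans hhi⟩
  exact ⟨hy', (H _ hy' _ ⟨by linarith [hm.2], by linarith [hm.1]⟩).const_mul (hκ y hy)⟩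

theorem eqBounded_T1 (hP : P.Pos)
    (H : ∀ x ∈ Icc 0 P.L, ∀ s ∈ Icc 0 P.D, EqBounded (ψ x s) (ψ' x s) (h (x, s)))
    (hx : 0 ≤ x) (hs : s ∈ Icc 0 P.D) (hxs : x ≤ P.c1 * s) :
    EqBounded (P.T1 ψ x s - ψ x s) (P.T1 ψ' x s - ψ' x s)
      (5 * (ENNReal.ofReal P.coeffBound * volterraMajorant P.L P.D P.c1 P.c4 h (x, s))) := by
  have k2 := (P.abs_coeff_le hP).2.1
  have hP' := hP
  obtain ⟨-, -, h1, h2, -, h4, -, -, -, -, hLD⟩ := hP'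
  have hq : P.c1 * (x / P.c1) = x := mul_div_cancel₀ _ h1.ne'
  have hq0 : 0 ≤ x / P.c1 := by positivity
  have hqs : x / P.c1 ≤ s := by rwa [div_le_iff₀' h1]
  have hsL : P.c1 * s + P.c4 * s < P.L := by nlinarith [hs.2]
  have hsD := hs.2
  have hs1 := mul_nonneg h1.le hs.1
  have hs4 := mul_nonneg h4.le hs.1
  have hq4 := mul_nonneg h4.le hq0
  have e1 := eqBounded_integral_left hP H (by linarith) hs.2 hq0 hqs hq.le
  have e2 : EqBounded
      (∫ τ in (x / P.c1)..s,
        P.c5 * P.c7 * Real.exp (-(P.c2 * x)) * ψ (P.c4 * (τ - x / P.c1)) (s - τ))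
      (∫ τ in (x / P.c1)..s,
        P.c5 * P.c7 * Real.exp (-(P.c2 * x)) * ψ' (P.c4 * (τ - x / P.c1)) (s - τ))
      (ENNReal.ofReal P.coeffBound * volterraMajorant P.L P.D P.c1 P.c4 h (x, s)) := by
    refine EqBounded.integral ENNReal.ofReal_ne_top hqs fun τ hτ => ?_
    have a := mul_le_mul_of_nonneg_left hτ.2 h4.le
    have b := mul_nonneg h4.le (sub_nonneg.2 hτ.1)
    refine ⟨⟨hq0.trans hτ.1, by linarith [hτ.2]⟩, ((H _ ⟨b, by linarith⟩ _
      ⟨by linarith [hτ.2], by linarith [hτ.1]⟩).const_mul (abs_mul_exp_le k2 ?_)).mono ?_⟩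
    · nlinarith
    · gcongr; exact le_delayed_reflected ..
  have e3 := eqBounded_integral_right hP H hx hs.2 hs.1 le_rfl (by linarith)
  have e4 := eqBounded_integral_integral (x := x) H hs.2 le_rfl hs.1
    (lo := fun τ => max (x - P.c1 * τ) (P.c4 * (τ - x / P.c1))) (hi := fun τ => x + P.c4 * τ)
    (κ := fun y τ => P.gk x y τ) fun τ hτ => by
      have a := mul_le_mul_of_nonneg_left hτ.2 h4.le
      have b := mul_nonneg h4.le hτ.1
      have b' := mul_nonneg h1.le hτ.1
      refine ⟨?_, max_le (by linarith) (by linarith), by linarith, fun y hy => P.abs_gk_le hP hy.2⟩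
      rcases le_total τ (x / P.c1) with h' | h'
      · exact le_max_of_le_left (by linarith [mul_le_mul_of_nonneg_left h' h1.le])
      · exact le_max_of_le_right (mul_nonneg h4.le (sub_nonneg.2 h'))
  refine EqBounded.mono (g := _) ?_ (mul_le_mul_left (show (4 : ℝ≥0∞) ≤ 5 by norm_num) _)
  convert ((e1.neg.add e2).add e3).sub e4 using 1
  · unfold T1; ring
  · unfold T1; ring
  · ring

theorem eqBounded_T2 (hP : P.Pos)
    (H : ∀ x ∈ Icc 0 P.L, ∀ s ∈ Icc 0 P.D, EqBounded (ψ x s) (ψ' x s) (h (x, s)))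
    (hs : s ∈ Icc 0 P.D) (hxs : P.c1 * s ≤ x) (hxL : x ≤ P.L - P.c4 * s) :
    EqBounded (P.T2 ψ x s - ψ x s) (P.T2 ψ' x s - ψ' x s)
      (5 * (ENNReal.ofReal P.coeffBound * volterraMajorant P.L P.D P.c1 P.c4 h (x, s))) := by
  have hP' := hP
  obtain ⟨-, -, h1, h2, -, h4, -⟩ := hP'
  have hs1 := mul_nonneg h1.le hs.1
  have hs4 := mul_nonneg h4.le hs.1
  have e1 := eqBounded_integral_left (x := x) hP H (by linarith) hs.2 hs.1 le_rfl hxs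
  have e3 := eqBounded_integral_right (x := x) hP H (by linarith) hs.2 hs.1 le_rfl (by linarith)
  have e4 := eqBounded_integral_integral (x := x) H hs.2 le_rfl hs.1
    (lo := fun τ => x - P.c1 * τ) (hi := fun τ => x + P.c4 * τ)
    (κ := fun y τ => P.gk x y τ) fun τ hτ => by
      have a := mul_le_mul_of_nonneg_left hτ.2 h4.le
      have a' := mul_le_mul_of_nonneg_left hτ.2 h1.le
      have b := mul_nonneg h4.le hτ.1
      have b' := mul_nonneg h1.le hτ.1
      exact ⟨by linarith, by linarith, by linarith, fun y hy => P.abs_gk_le hP hy.2⟩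
  refine EqBounded.mono (g := _) ?_ (mul_le_mul_left (show (3 : ℝ≥0∞) ≤ 5 by norm_num) _)
  convert (e1.neg.add e3).sub e4 using 1
  · unfold T2; ring
  · unfold T2; ring
  · ring

theorem eqBounded_T3 (hP : P.Pos)
    (H : ∀ x ∈ Icc 0 P.L, ∀ s ∈ Icc 0 P.D, EqBounded (ψ x s) (ψ' x s) (h (x, s)))
    (hs : s ∈ Icc 0 P.D) (hxs : P.L - P.c4 * s ≤ x) (hxL : x ≤ P.L) :
    EqBounded (P.T3 ψ x s - ψ x s) (P.T3 ψ' x s - ψ' x s)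
      (5 * (ENNReal.ofReal P.coeffBound * volterraMajorant P.L P.D P.c1 P.c4 h (x, s))) := by
  have k3 := (P.abs_coeff_le hP).2.2.1
  have k5 := (P.abs_coeff_le hP).2.2.2.2.1
  have hP' := hP
  obtain ⟨hL, -, h1, h2, -, h4, -, -, -, -, hLD⟩ := hP'
  have hp : P.c4 * ((P.L - x) / P.c4) = P.L - x := mul_div_cancel₀ _ h4.ne'
  have hp0 : 0 ≤ (P.L - x) / P.c4 := div_nonneg (sub_nonneg.2 hxL) h4.le
  have hps : (P.L - x) / P.c4 ≤ s := by rw [div_le_iff₀' h4]; linarith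
  have hsL : P.c1 * s + P.c4 * s < P.L := by nlinarith [hs.2]
  have hsD := hs.2
  have hs1 := mul_nonneg h1.le hs.1
  have hs4 := mul_nonneg h4.le hs.1
  have hp1 := mul_nonneg h1.le hp0
  have e1 := eqBounded_integral_left (x := x) hP H hxL hs.2 hs.1 le_rfl (by linarith)
  have e2 := eqBounded_integral_right (x := x) hP H (by linarith) hs.2 hp0 hps (by linarith)
  have e3 : EqBounded
      (∫ τ in ((P.L - x) / P.c4)..s, P.k * ψ P.L (s - τ))
      (∫ τ in ((P.L - x) / P.c4)..s, P.k * ψ' P.L (s - τ))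
      (ENNReal.ofReal P.coeffBound * volterraMajorant P.L P.D P.c1 P.c4 h (x, s)) := by
    refine EqBounded.integral ENNReal.ofReal_ne_top hps fun τ hτ => ?_
    refine ⟨⟨hp0.trans hτ.1, by linarith [hτ.2]⟩, ((H _ ⟨hL.le, le_rfl⟩ _
      ⟨by linarith [hτ.2], by linarith [hτ.1]⟩).const_mul k3).mono ?_⟩
    gcongr; exact le_delayed_trace ..
  have e4 := eqBounded_integral_integral (x := x) H hs.2 le_rfl hs.1
    (lo := fun τ => x - P.c1 * τ) (hi := fun τ => min (x + P.c4 * τ) (P.cc x τ))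
    (κ := fun y τ => P.gk x y τ) fun τ hτ => by
      have a' := mul_le_mul_of_nonneg_left hτ.2 h1.le
      have b := mul_nonneg h4.le hτ.1
      have b' := mul_nonneg h1.le hτ.1
      rw [P.cc_eq h4.ne']
      refine ⟨by linarith, le_min (by linarith) (by linarith), ?_,
        fun y hy => P.abs_gk_le hP (hy.2.trans (min_le_left _ _))⟩
      rcases le_total τ ((P.L - x) / P.c4) with h' | h'
      · exact min_le_of_left_le (by linarith [mul_le_mul_of_nonneg_left h' h4.le])
      · exact min_le_of_right_le (by linarith [mul_le_mul_of_nonneg_left h' h1.le])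
  have e5 := eqBounded_integral_integral (x := x) H hs.2 hp0 hps
    (lo := fun τ => P.cc x τ) (hi := fun _ => P.L)
    (κ := fun _ _ => P.k * P.c2 * Real.exp (-(P.c2 * P.L))) fun τ hτ => by
      have a := mul_le_mul_of_nonneg_left hτ.2 h1.le
      have b := mul_le_mul_of_nonneg_left hτ.1 h1.le
      rw [P.cc_eq h4.ne']
      exact ⟨by linarith, by linarith, le_rfl, fun y hy => abs_mul_exp_le k5 (by nlinarith)⟩
  convert (((e1.neg.add e2).add e3).sub e4).sub e5 using 1
  · unfold T3; ring
  · unfold T3; ring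
  · ring

variable {z z' v v' : ℝ → ℝ} {ζ w : ℝ → ℝ≥0∞}

theorem eqBounded_Z1_add_Y1 (hP : P.Pos) (Hz : ∀ y ∈ Icc 0 P.L, EqBounded (z y) (z' y) (ζ y))
    (Hv : ∀ y ∈ Icc 0 P.L, EqBounded (v y) (v' y) (w y))
    (hx : 0 ≤ x) (hs : s ∈ Icc 0 P.D) (hxs : x ≤ P.c1 * s) :
    EqBounded (P.Z1 z x s + P.Y1 v x s) (P.Z1 z' x s + P.Y1 v' x s)
      (5 * (ENNReal.ofReal P.coeffBound * dataMajorant P.L P.c1 P.c4 ζ w (x, s))) := by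
  obtain ⟨-, -, -, -, -, -, -, -, k9, k10, k11, k12⟩ := P.abs_coeff_le hP
  have hP' := hP
  obtain ⟨-, -, h1, h2, -, h4, -, -, -, -, hLD⟩ := hP'
  have hq : P.c1 * (x / P.c1) = x := mul_div_cancel₀ _ h1.ne'
  have hq0 : 0 ≤ x / P.c1 := by positivity
  have hqs : x / P.c1 ≤ s := by rwa [div_le_iff₀' h1]
  have hsL : P.c1 * s + P.c4 * s < P.L := by nlinarith [hs.2]
  have hs1 := mul_nonneg h1.le hs.1
  have hs4 := mul_nonneg h4.le hs.1
  have hq4 := mul_nonneg h4.le hq0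
  have hr : 0 ≤ P.c4 * (s - x / P.c1) := mul_nonneg h4.le (sub_nonneg.2 hqs)
  have hx2 := mul_nonneg h2.le hx
  have e1 : EqBounded
      (∫ y in (0:ℝ)..(P.c4 * (s - x / P.c1)),
        P.c5 * (P.k + P.c5 * P.c7) / (P.c6 * (P.c1 + P.c4)) * Real.exp (-(P.c2 * (x + y))) * z y)
      (∫ y in (0:ℝ)..(P.c4 * (s - x / P.c1)),
        P.c5 * (P.k + P.c5 * P.c7) / (P.c6 * (P.c1 + P.c4)) * Real.exp (-(P.c2 * (x + y))) * z' y)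
      (ENNReal.ofReal P.coeffBound * ∫⁻ y in Icc 0 P.L, ζ y) :=
    EqBounded.integral ENNReal.ofReal_ne_top hr fun y hy => by
      have hy' : y ∈ Icc 0 P.L := ⟨hy.1, by linarith [hy.2]⟩
      exact ⟨hy', (Hz y hy').const_mul
        (abs_mul_exp_le k9 (by nlinarith [mul_nonneg h2.le hy.1]))⟩
  have e2 : EqBounded
      (∫ y in (P.c4 * (s - x / P.c1))..(x + P.c4 * s), P.kk x s y * z y)
      (∫ y in (P.c4 * (s - x / P.c1))..(x + P.c4 * s), P.kk x s y * z' y)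
      (ENNReal.ofReal P.coeffBound * ∫⁻ y in Icc 0 P.L, ζ y) :=
    EqBounded.integral ENNReal.ofReal_ne_top (by linarith) fun y hy => by
      have hy' : y ∈ Icc 0 P.L := ⟨hr.trans hy.1, by linarith [hy.2]⟩
      exact ⟨hy', (Hz y hy').const_mul (P.abs_kk_le hP hx hs.1 hy'.1)⟩
  have e3 := (Hv (P.c4 * (s - x / P.c1)) ⟨hr, by linarith⟩).const_mul
    (abs_mul_exp_le (K := P.coeffBound) (C := -(P.c5 * P.c7 / P.c6)) (by rw [abs_neg]; exact k10) (neg_nonpos.2 hx2))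
  have e4 := (Hv (x + P.c4 * s) ⟨by linarith, by linarith⟩).const_mul k11
  have e5 : EqBounded
      (∫ y in (0:ℝ)..(P.c4 * (s - x / P.c1)),
        P.c1 * P.c5 * P.c7 * (P.k + P.c5 * P.c7) / (P.c4 * P.c6 * (P.c1 + P.c4)) *
          Real.exp (-(P.c2 * x)) * v y)
      (∫ y in (0:ℝ)..(P.c4 * (s - x / P.c1)),
        P.c1 * P.c5 * P.c7 * (P.k + P.c5 * P.c7) / (P.c4 * P.c6 * (P.c1 + P.c4)) *
          Real.exp (-(P.c2 * x)) * v' y)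
      (ENNReal.ofReal P.coeffBound * ∫⁻ y in Icc 0 P.L, w y) :=
    EqBounded.integral ENNReal.ofReal_ne_top hr fun y hy => by
      have hy' : y ∈ Icc 0 P.L := ⟨hy.1, by linarith [hy.2]⟩
      exact ⟨hy', (Hv y hy').const_mul (abs_mul_exp_le k12 (neg_nonpos.2 hx2))⟩
  have i1 := mul_le_mul_right (le_dataMajorant_integral_z P.L P.c1 P.c4 ζ w x s)
    (ENNReal.ofReal P.coeffBound)
  have i3 := mul_le_mul_right (le_dataMajorant_reflected P.L P.c1 P.c4 ζ w x s)
    (ENNReal.ofReal P.coeffBound)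
  have i4 := mul_le_mul_right (le_dataMajorant_right P.L P.c1 P.c4 ζ w x s)
    (ENNReal.ofReal P.coeffBound)
  have i5 := mul_le_mul_right (le_dataMajorant_integral_v P.L P.c1 P.c4 ζ w x s)
    (ENNReal.ofReal P.coeffBound)
  convert ((e1.mono i1).add (e2.mono i1)).add (((e3.mono i3).sub (e4.mono i4)).sub (e5.mono i5))
    using 1
  · unfold Z1 Y1; ring
  · unfold Z1 Y1; ring
  · ring

theorem eqBounded_Z2_add_Y2 (hP : P.Pos) (Hz : ∀ y ∈ Icc 0 P.L, EqBounded (z y) (z' y) (ζ y))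
    (Hv : ∀ y ∈ Icc 0 P.L, EqBounded (v y) (v' y) (w y))
    (hs : s ∈ Icc 0 P.D) (hxs : P.c1 * s ≤ x) (hxL : x ≤ P.L - P.c4 * s) :
    EqBounded (P.Z2 z x s + P.Y2 v x s) (P.Z2 z' x s + P.Y2 v' x s)
      (5 * (ENNReal.ofReal P.coeffBound * dataMajorant P.L P.c1 P.c4 ζ w (x, s))) := by
  obtain ⟨-, -, -, -, -, k6, -, -, -, -, k11, -⟩ := P.abs_coeff_le hP
  have hP' := hP
  obtain ⟨-, -, h1, h2, -, h4, -⟩ := hP'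
  have hs1 := mul_nonneg h1.le hs.1
  have hs4 := mul_nonneg h4.le hs.1
  have hx : 0 ≤ x := by linarith
  have e1 := (Hz (x - P.c1 * s) ⟨by linarith, by linarith⟩).const_mul
    (abs_mul_exp_le k6 (neg_nonpos.2 (mul_nonneg h2.le hx)))
  have e2 : EqBounded
      (∫ y in (x - P.c1 * s)..(x + P.c4 * s), P.kk x s y * z y)
      (∫ y in (x - P.c1 * s)..(x + P.c4 * s), P.kk x s y * z' y)
      (ENNReal.ofReal P.coeffBound * ∫⁻ y in Icc 0 P.L, ζ y) :=
    EqBounded.integral ENNReal.ofReal_ne_top (by linarith) fun y hy => by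
      have hy' : y ∈ Icc 0 P.L := ⟨by linarith [hy.1], by linarith [hy.2]⟩
      exact ⟨hy', (Hz y hy').const_mul (P.abs_kk_le hP hx hs.1 hy'.1)⟩
  have e3 := (Hv (x + P.c4 * s) ⟨by linarith, by linarith⟩).const_mul
    (K := P.coeffBound) (c := -(P.k / P.c6)) (by rw [abs_neg]; exact k11)
  have i1 := mul_le_mul_right (le_dataMajorant_left P.L P.c1 P.c4 ζ w x s)
    (ENNReal.ofReal P.coeffBound)
  have i2 := mul_le_mul_right (le_dataMajorant_integral_z P.L P.c1 P.c4 ζ w x s)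
    (ENNReal.ofReal P.coeffBound)
  have i3 := mul_le_mul_right (le_dataMajorant_right P.L P.c1 P.c4 ζ w x s)
    (ENNReal.ofReal P.coeffBound)
  refine EqBounded.mono (g := _) ?_ (mul_le_mul_left (show (3 : ℝ≥0∞) ≤ 5 by norm_num) _)
  convert ((e1.mono i1).add (e2.mono i2)).add (e3.mono i3) using 1
  · unfold Z2 Y2; ring
  · unfold Z2 Y2; ring
  · ring

theorem eqBounded_Z3_sub (hP : P.Pos) (Hz : ∀ y ∈ Icc 0 P.L, EqBounded (z y) (z' y) (ζ y))
    (Hv : ∀ y ∈ Icc 0 P.L, EqBounded (v y) (v' y) (w y))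
    (hs : s ∈ Icc 0 P.D) (hxs : P.L - P.c4 * s ≤ x) (hxL : x ≤ P.L) :
    EqBounded (P.Z3 z x s - P.k / P.c6 * v P.L) (P.Z3 z' x s - P.k / P.c6 * v' P.L)
      (5 * (ENNReal.ofReal P.coeffBound * dataMajorant P.L P.c1 P.c4 ζ w (x, s))) := by
  obtain ⟨-, -, -, -, -, k6, -, k8, -, -, k11, -⟩ := P.abs_coeff_le hP
  have hP' := hP
  obtain ⟨hL, -, h1, h2, -, h4, -, -, -, -, hLD⟩ := hP'
  have hp : P.c4 * ((P.L - x) / P.c4) = P.L - x := mul_div_cancel₀ _ h4.ne'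
  have hp0 : 0 ≤ (P.L - x) / P.c4 := div_nonneg (sub_nonneg.2 hxL) h4.le
  have hps : (P.L - x) / P.c4 ≤ s := by rw [div_le_iff₀' h4]; linarith
  have hsL : P.c1 * s + P.c4 * s < P.L := by nlinarith [hs.2]
  have hs1 := mul_nonneg h1.le hs.1
  have hp1 := mul_nonneg h1.le hp0
  have hps1 := mul_le_mul_of_nonneg_left hps h1.le
  have hx : 0 ≤ x := by linarith
  have hcc := P.cc_eq h4.ne' x s
  have e1 := (Hz (x - P.c1 * s) ⟨by linarith, by linarith⟩).const_mul
    (abs_mul_exp_le k6 (neg_nonpos.2 (mul_nonneg h2.le hx)))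
  have e2 : EqBounded
      (∫ y in (P.cc x s)..P.L,
        P.k * P.c5 / (P.c1 * P.c6) * Real.exp (-(P.c2 * P.L)) * z y)
      (∫ y in (P.cc x s)..P.L,
        P.k * P.c5 / (P.c1 * P.c6) * Real.exp (-(P.c2 * P.L)) * z' y)
      (ENNReal.ofReal P.coeffBound * ∫⁻ y in Icc 0 P.L, ζ y) :=
    EqBounded.integral ENNReal.ofReal_ne_top (by linarith) fun y hy => by
      have hy' : y ∈ Icc 0 P.L := ⟨by linarith [hy.1], hy.2⟩
      exact ⟨hy', (Hz y hy').const_mul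
        (abs_mul_exp_le k8 (neg_nonpos.2 (mul_nonneg h2.le hL.le)))⟩
  have e3 : EqBounded
      (∫ y in (x - P.c1 * s)..(P.cc x s), P.kk x s y * z y)
      (∫ y in (x - P.c1 * s)..(P.cc x s), P.kk x s y * z' y)
      (ENNReal.ofReal P.coeffBound * ∫⁻ y in Icc 0 P.L, ζ y) :=
    EqBounded.integral ENNReal.ofReal_ne_top (by linarith) fun y hy => by
      have hy' : y ∈ Icc 0 P.L := ⟨by linarith [hy.1], by linarith [hy.2]⟩
      exact ⟨hy', (Hz y hy').const_mul (P.abs_kk_le hP hx hs.1 hy'.1)⟩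
  have e4 := (Hv P.L ⟨hL.le, le_rfl⟩).const_mul k11
  have i1 := mul_le_mul_right (le_dataMajorant_left P.L P.c1 P.c4 ζ w x s)
    (ENNReal.ofReal P.coeffBound)
  have i2 := mul_le_mul_right (le_dataMajorant_integral_z P.L P.c1 P.c4 ζ w x s)
    (ENNReal.ofReal P.coeffBound)
  have i4 := mul_le_mul_right (le_dataMajorant_trace P.L P.c1 P.c4 ζ w x s)
    (ENNReal.ofReal P.coeffBound)
  refine EqBounded.mono (g := _) ?_ (mul_le_mul_left (show (4 : ℝ≥0∞) ≤ 5 by norm_num) _)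
  convert (((e1.mono i1).add (e2.mono i2)).add (e3.mono i2)).sub (e4.mono i4) using 1
  · unfold Z3; ring
  · unfold Z3; ring
  · ring

theorem eqBounded_beta (hP : P.Pos)
    (H : ∀ x ∈ Icc 0 P.L, ∀ s ∈ Icc 0 P.D, EqBounded (ψ x s) (ψ' x s) (h (x, s)))
    (Hz : ∀ y ∈ Icc 0 P.L, EqBounded (z y) (z' y) (ζ y))
    (Hv : ∀ y ∈ Icc 0 P.L, EqBounded (v y) (v' y) (w y))
    (hx : x ∈ Icc 0 P.L) (hs : s ∈ Icc 0 P.D) :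
    EqBounded (P.beta ψ z v x s - ψ x s) (P.beta ψ' z' v' x s - ψ' x s)
      (5 * ENNReal.ofReal P.coeffBound *
        (volterraMajorant P.L P.D P.c1 P.c4 h (x, s)
          + dataMajorant P.L P.c1 P.c4 ζ w (x, s))) := by
  unfold beta
  split_ifs with hx1 hx2
  · convert (eqBounded_T1 hP H hx.1 hs hx1).add (eqBounded_Z1_add_Y1 hP Hz Hv hx.1 hs hx1) using 1
      <;> ring
  · push Not at hx1
    convert (eqBounded_T2 hP H hs hx1.le hx2).add (eqBounded_Z2_add_Y2 hP Hz Hv hs hx1.le hx2)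
      using 1 <;> ring
  · push Not at hx2
    convert (eqBounded_T3 hP H hs hx2.le hx.2).add (eqBounded_Z3_sub hP Hz Hv hs hx2.le hx.2)
      using 1 <;> ring

end Bounds

end Params

section Continuity

@[fun_prop]
theorem continuous_integral_variable_limits {X : Type*} [TopologicalSpace X] {f : X → ℝ → ℝ}
    {a b : X → ℝ} (hf : Continuous (Function.uncurry f)) (ha : Continuous a) (hb : Continuous b) :
    Continuous fun p => ∫ t in (a p)..(b p), f p t := by
  have hi (p : X) (u w : ℝ) : IntervalIntegrable (f p) volume u w :=
    (hf.comp (Continuous.prodMk_right p)).intervalIntegrable u w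
  simp_rw [← intervalIntegral.integral_interval_sub_left (hi _ 0 (b _)) (hi _ 0 (a _))]
  exact (intervalIntegral.continuous_parametric_intervalIntegral_of_continuous hf hb).sub
    (intervalIntegral.continuous_parametric_intervalIntegral_of_continuous hf ha)

namespace Params

variable (P : Params)

@[fun_prop]
theorem continuous_gk {X : Type*} [TopologicalSpace X] {x y τ : X → ℝ} (hx : Continuous x)
    (hy : Continuous y) (hτ : Continuous τ) : Continuous fun p => P.gk (x p) (y p) (τ p) := by
  unfold gk; fun_prop

@[fun_prop]
theorem continuous_kk {X : Type*} [TopologicalSpace X] {x s y : X → ℝ} (hx : Continuous x)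
    (hs : Continuous s) (hy : Continuous y) : Continuous fun p => P.kk (x p) (s p) (y p) := by
  unfold kk; fun_prop

@[fun_prop]
theorem continuous_cc {X : Type*} [TopologicalSpace X] {x τ : X → ℝ} (hx : Continuous x)
    (hτ : Continuous τ) : Continuous fun p => P.cc (x p) (τ p) := by
  unfold cc; fun_prop

theorem measurable_beta {ψ : ℝ → ℝ → ℝ} {z v : ℝ → ℝ} (hψ : Continuous (Function.uncurry ψ))
    (hz : Continuous z) (hv : Continuous v) :
    Measurable fun p : ℝ × ℝ => P.beta ψ z v p.1 p.2 := by
  have hψ' {X : Type _} [TopologicalSpace X] {a b : X → ℝ} (ha : Continuous a)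
      (hb : Continuous b) : Continuous fun p => ψ (a p) (b p) := hψ.comp (ha.prodMk hb)
  unfold beta
  refine Measurable.ite (measurableSet_le (by fun_prop) (by fun_prop)) ?_
    (Measurable.ite (measurableSet_le (by fun_prop) (by fun_prop)) ?_ ?_) <;>
    refine Continuous.measurable ?_
  · unfold T1 Z1 Y1
    fun_prop
  · unfold T2 Z2 Y2
    fun_prop
  · unfold T3 Z3
    fun_prop

end Params

end Continuity

section ToReal

theorem intervalIntegral_sq_eq_toReal {a : ℝ} (ha : 0 ≤ a) {f : ℝ → ℝ} (hf : Measurable f) :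
    ∫ x in (0:ℝ)..a, f x ^ 2 = (∫⁻ x in Icc 0 a, ‖f x‖ₑ ^ 2).toReal := by
  rw [intervalIntegral.integral_of_le ha,
    integral_eq_lintegral_of_nonneg_ae (.of_forall fun x => sq_nonneg (f x))
      (hf.pow_const 2).aestronglyMeasurable, Measure.restrict_congr_set Ioc_ae_eq_Icc]
  congr 1
  refine lintegral_congr fun x => ?_
  rw [← enorm_pow, Real.enorm_of_nonneg (sq_nonneg _)]

theorem n2_add_nS_eq_toReal {L D : ℝ} (hL : 0 ≤ L) (hD : 0 ≤ D) {f : ℝ → ℝ → ℝ}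
    (hf : Measurable (Function.uncurry f))
    (hfin : sqNorm L D (fun p => ‖f p.1 p.2‖ₑ) ≠ ∞) :
    n2 L D f + nS D (f L) = (sqNorm L D fun p => ‖f p.1 p.2‖ₑ).toReal := by
  have hm : Measurable fun x => ∫⁻ s in Icc 0 D, ‖f x s‖ₑ ^ 2 :=
    (hf.enorm.pow_const 2).lintegral_prod_right'
  rw [sqNorm, lintegral_traceMeasure] at hfin ⊢
  obtain ⟨h1, h2⟩ := ENNReal.add_ne_top.1 hfin
  rw [ENNReal.toReal_add h1 h2, n2, nS,
    intervalIntegral_sq_eq_toReal hD (hf.of_uncurry_left (x := L)), intervalIntegral.integral_of_le hL]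
  congr 1
  simp_rw [intervalIntegral_sq_eq_toReal hD (hf.of_uncurry_left)]
  rw [Measure.restrict_congr_set Ioc_ae_eq_Icc]
  exact integral_toReal hm.aemeasurable (ae_lt_top hm h1)

theorem nX_congr {L : ℝ} (hL : 0 ≤ L) {f g : ℝ → ℝ} (h : ∀ x ∈ Icc 0 L, f x = g x) :
    nX L f = nX L g :=
  intervalIntegral.integral_congr fun x hx => by
    rw [uIcc_of_le hL] at hx
    exact congrArg (· ^ 2) (h x hx)

theorem n2_congr {L D : ℝ} (hL : 0 ≤ L) (hD : 0 ≤ D) {f g : ℝ → ℝ → ℝ}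
    (h : ∀ x ∈ Icc 0 L, ∀ s ∈ Icc 0 D, f x s = g x s) : n2 L D f = n2 L D g :=
  intervalIntegral.integral_congr fun x hx => by
    rw [uIcc_of_le hL] at hx
    exact nX_congr hD (h x hx)

end ToReal

theorem sqNorm_ne_top {L D : ℝ} (hL : 0 ≤ L) {f : ℝ × ℝ → ℝ≥0∞} {M : ℝ≥0∞} (hM : M ≠ ∞)
    (h : ∀ x ∈ Icc 0 L, ∀ s ∈ Icc 0 D, f (x, s) ≤ M) : sqNorm L D f ≠ ∞ := by
  refine ne_top_of_le_ne_top ?_ (sqNorm_mono (g := fun _ => M) hL h)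
  simp only [sqNorm, lintegral_const]
  finiteness

theorem le_mul_toReal_add {A : ℝ≥0∞} (hA : A ≠ ∞) {a b d : ℝ≥0∞} (hb : b ≠ ∞) (hd : d ≠ ∞)
    (h : a ≤ A * (b + d)) : d.toReal + a.toReal ≤ (A.toReal + 1) * (d.toReal + b.toReal) := by
  have h' := ENNReal.toReal_mono (by finiteness) h
  rw [ENNReal.toReal_mul, ENNReal.toReal_add hb hd] at h'
  nlinarith [b.toReal_nonneg]

theorem Params.exists_lyapunov_equiv (P : Params) (hP : P.Pos) :
    ∃ C : ℝ, 0 < C ∧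
      ∀ (ψ : ℝ → ℝ → ℝ) (z v : ℝ → ℝ),
        ContinuousOn (fun p : ℝ × ℝ => ψ p.1 p.2) (Icc 0 P.L ×ˢ Icc 0 P.D) →
        ContinuousOn z (Icc 0 P.L) → ContinuousOn v (Icc 0 P.L) →
        nX P.L z + nX P.L v + v P.L ^ 2
              + (n2 P.L P.D (P.beta ψ z v) + nS P.D (P.beta ψ z v P.L))
            ≤ C * (nX P.L z + nX P.L v + v P.L ^ 2 + (n2 P.L P.D ψ + nS P.D (ψ P.L))) ∧
        nX P.L z + nX P.L v + v P.L ^ 2 + (n2 P.L P.D ψ + nS P.D (ψ P.L))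
            ≤ C * (nX P.L z + nX P.L v + v P.L ^ 2
              + (n2 P.L P.D (P.beta ψ z v) + nS P.D (P.beta ψ z v P.L))) := by
  have hL : 0 ≤ P.L := hP.1.le
  have hD : 0 ≤ P.D := hP.2.1.le
  have hLm : P.L ∈ Icc 0 P.L := ⟨hL, le_rfl⟩
  obtain ⟨A, hA, hequiv⟩ := exists_sqNorm_equiv (L := P.L) (D := P.D) (c1 := P.c1) (c4 := P.c4)
    (K := 5 * ENNReal.ofReal P.coeffBound) hL hP.2.2.1.ne' hP.2.2.2.2.2.1.ne' (by finiteness)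
  refine ⟨A.toReal + 1, by positivity, fun ψ z v hψ hz hv => ?_⟩
  -- continuous extensions of the data
  set ψ' : ℝ → ℝ → ℝ := fun x s => ψ (projIcc 0 P.L hL x) (projIcc 0 P.D hD s) with hψ'_def
  set z' : ℝ → ℝ := fun y => z (projIcc 0 P.L hL y)
  set v' : ℝ → ℝ := fun y => v (projIcc 0 P.L hL y)
  have hψc : Continuous (Function.uncurry ψ') :=
    hψ.comp_continuous (f := fun p : ℝ × ℝ =>
      ((projIcc 0 P.L hL p.1 : ℝ), (projIcc 0 P.D hD p.2 : ℝ))) (by fun_prop)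
      fun p => ⟨Subtype.coe_prop _, Subtype.coe_prop _⟩
  have hzc : Continuous z' := hz.comp_continuous (by fun_prop) fun y => Subtype.coe_prop _
  have hvc : Continuous v' := hv.comp_continuous (by fun_prop) fun y => Subtype.coe_prop _
  have eψ : ∀ x ∈ Icc 0 P.L, ∀ s ∈ Icc 0 P.D, ψ x s = ψ' x s := fun x hx s hs => by
    simp only [hψ'_def, projIcc_of_mem hL hx, projIcc_of_mem hD hs]
  have ez : ∀ y ∈ Icc 0 P.L, z y = z' y := fun y hy => by
    simp only [z', projIcc_of_mem hL hy]
  have ev : ∀ y ∈ Icc 0 P.L, v y = v' y := fun y hy => by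
    simp only [v', projIcc_of_mem hL hy]
  set h : ℝ × ℝ → ℝ≥0∞ := (Icc 0 P.L ×ˢ Icc 0 P.D).indicator fun p => ‖ψ' p.1 p.2‖ₑ with h_def
  set ζ : ℝ → ℝ≥0∞ := (Icc 0 P.L).indicator fun y => ‖z' y‖ₑ with hζ_def
  set w : ℝ → ℝ≥0∞ := (Icc 0 P.L).indicator fun y => ‖v' y‖ₑ with hw_def
  have hh (x) (hx : x ∈ Icc 0 P.L) (s) (hs : s ∈ Icc 0 P.D) : h (x, s) = ‖ψ' x s‖ₑ :=
    indicator_of_mem (mk_mem_prod hx hs) _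
  have hβ (x) (hx : x ∈ Icc 0 P.L) (s) (hs : s ∈ Icc 0 P.D) :=
    eqBounded_beta (ψ := ψ) (ψ' := ψ') (z := z) (z' := z') (v := v) (v' := v') (h := h) (ζ := ζ)
      (w := w) hP
      (fun x hx s hs => ⟨eψ x hx s hs, by rw [hh x hx s hs, eψ x hx s hs]⟩)
      (fun y hy => ⟨ez y hy, by rw [hζ_def, indicator_of_mem hy, ez y hy]⟩)
      (fun y hy => ⟨ev y hy, by rw [hw_def, indicator_of_mem hy, ev y hy]⟩) hx hs
  have eβ : ∀ x ∈ Icc 0 P.L, ∀ s ∈ Icc 0 P.D, P.beta ψ z v x s = P.beta ψ' z' v' x s :=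
    fun x hx s hs => by linarith [(hβ x hx s hs).1, eψ x hx s hs]
  have hβm : Measurable (Function.uncurry (P.beta ψ' z' v')) := P.measurable_beta hψc hzc hvc
  obtain ⟨M, hM⟩ := (isCompact_Icc.prod isCompact_Icc).exists_bound_of_continuousOn hψ
  have hψ_fin : sqNorm P.L P.D (fun p => ‖ψ' p.1 p.2‖ₑ) ≠ ∞ :=
    sqNorm_ne_top (M := ENNReal.ofReal M) hL ENNReal.ofReal_ne_top fun x hx s hs => by
      rw [← ofReal_norm, ← eψ x hx s hs]
      exact ENNReal.ofReal_le_ofReal (hM (x, s) ⟨hx, hs⟩)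
  have hhψ : sqNorm P.L P.D h = sqNorm P.L P.D fun p => ‖ψ' p.1 p.2‖ₑ :=
    le_antisymm (sqNorm_mono hL fun x hx s hs => (hh x hx s hs).le)
      (sqNorm_mono hL fun x hx s hs => (hh x hx s hs).ge)
  have hI (f : ℝ → ℝ) : ∫⁻ y, (Icc 0 P.L).indicator (fun y => ‖f y‖ₑ) y ^ 2
      = ∫⁻ y in Icc 0 P.L, ‖f y‖ₑ ^ 2 := by
    rw [← lintegral_indicator measurableSet_Icc]
    refine lintegral_congr fun y => ?_
    by_cases hy : y ∈ Icc 0 P.L <;> simp [hy]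
  have hI_fin {f : ℝ → ℝ} (hf : Continuous f) : ∫⁻ y in Icc 0 P.L, ‖f y‖ₑ ^ 2 ≠ ∞ := by
    have := ((hf.pow 2).integrableOn_Icc (μ := volume) (a := 0) (b := P.L)).hasFiniteIntegral
    simpa only [HasFiniteIntegral, Pi.pow_apply, enorm_pow] using this.ne
  have hwL : w P.L = ‖v' P.L‖ₑ := indicator_of_mem hLm _
  set d : ℝ≥0∞ := (∫⁻ y, ζ y ^ 2) + (∫⁻ y, w y ^ 2) + w P.L ^ 2 with hd_def
  have hd : d ≠ ∞ := by
    rw [hd_def, hζ_def, hw_def, hI, hI, ← hw_def, hwL]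
    have h1 := hI_fin hzc
    have h2 := hI_fin hvc
    finiteness
  have hd' : nX P.L z + nX P.L v + v P.L ^ 2 = d.toReal := by
    rw [hd_def, hζ_def, hw_def, hI, hI, ← hw_def, hwL, ENNReal.toReal_add (by
      have h1 := hI_fin hzc
      have h2 := hI_fin hvc
      finiteness) (by finiteness), ENNReal.toReal_add (hI_fin hzc) (hI_fin hvc), nX_congr hL ez,
      nX_congr hL ev, ev _ hLm, nX, nX, intervalIntegral_sq_eq_toReal hL hzc.measurable,
      intervalIntegral_sq_eq_toReal hL hvc.measurable]
    simp
  obtain ⟨h1, h2⟩ := hequiv h (fun p => ‖P.beta ψ' z' v' p.1 p.2‖ₑ) ζ w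
    (hψc.measurable.enorm.indicator (measurableSet_Icc.prod measurableSet_Icc))
    (hzc.measurable.enorm.indicator measurableSet_Icc)
    (hvc.measurable.enorm.indicator measurableSet_Icc)
    (fun x hx s => indicator_of_notMem (fun hm => hx hm.1) _)
    (fun x s hs => indicator_of_notMem (fun hm => hs hm.2) _)
    (hhψ ▸ hψ_fin)
    (fun x hx s hs => by
      have hb := hβ x hx s hs
      rw [hh x hx s hs, ← add_sub_cancel (ψ' x s) (P.beta ψ' z' v' x s)]
      exact (enorm_add_le _ _).trans (add_le_add le_rfl (hb.1 ▸ hb.2)))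
    (fun x hx s hs => by
      have hb := hβ x hx s hs
      rw [hh x hx s hs, ← sub_sub_cancel (P.beta ψ' z' v' x s) (ψ' x s)]
      exact enorm_sub_le.trans (add_le_add (by simp) (hb.1 ▸ hb.2)))
  rw [hhψ] at h1 h2
  have hβ_fin : sqNorm P.L P.D (fun p => ‖P.beta ψ' z' v' p.1 p.2‖ₑ) ≠ ∞ :=
    ne_top_of_le_ne_top (by finiteness) h1
  have hnS {f g : ℝ → ℝ → ℝ} (hfg : ∀ x ∈ Icc 0 P.L, ∀ s ∈ Icc 0 P.D, f x s = g x s) :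
      nS P.D (f P.L) = nS P.D (g P.L) := nX_congr hD (hfg _ hLm)
  rw [hd', n2_congr hL hD eψ, n2_congr hL hD eβ, hnS eψ, hnS eβ,
    n2_add_nS_eq_toReal hL hD hψc.measurable hψ_fin, n2_add_nS_eq_toReal hL hD hβm hβ_fin]
  exact ⟨le_mul_toReal_add hA hψ_fin hd h1, le_mul_toReal_add hA hβ_fin hd h2⟩

/-- Equivalence of the Lyapunov functionals `V1` (original variables)
and `V2` (transformed variables). -/
theorem lyapunov_functionals_equivalent (P : Params) (hP : P.Pos)
    (hc : P.c2 * P.c4 = P.c5 * P.c7) (hc' : P.c1 * P.c2 * P.c6 = P.c3 * P.c5) :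
    ∃ α1 α2 : ℝ, 0 < α1 ∧ 0 < α2 ∧
      ∀ (ψ : ℝ → ℝ → ℝ) (z v : ℝ → ℝ),
        ContinuousOn (fun p : ℝ × ℝ => ψ p.1 p.2) (Icc 0 P.L ×ˢ Icc 0 P.D) →
        ContinuousOn z (Icc 0 P.L) → ContinuousOn v (Icc 0 P.L) →
        z 0 = -P.c7 * v 0 →
        α1 * (nX P.L z + nX P.L v + v P.L ^ 2 + n2 P.L P.D (P.beta ψ z v)
                + nS P.D (fun s => P.beta ψ z v P.L s))
            ≤ nX P.L z + nX P.L v + v P.L ^ 2 + n2 P.L P.D ψ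
                + nS P.D (fun s => ψ P.L s) ∧
        nX P.L z + nX P.L v + v P.L ^ 2 + n2 P.L P.D ψ + nS P.D (fun s => ψ P.L s)
          ≤ α2 * (nX P.L z + nX P.L v + v P.L ^ 2 + n2 P.L P.D (P.beta ψ z v)
                + nS P.D (fun s => P.beta ψ z v P.L s)) := by
  obtain ⟨C, hC, h⟩ := P.exists_lyapunov_equiv hP
  refine ⟨C⁻¹, C, inv_pos.2 hC, hC, fun ψ z v hψ hz hv _ => ?_⟩
  obtain ⟨h1, h2⟩ := h ψ z v hψ hz hv
  simp only [← add_assoc] at h1 h2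
  exact ⟨(inv_mul_le_iff₀ hC).2 h1, h2⟩
end
end
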